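/- arXiv:2605.15201 — 7 statements merged into one kernel-verified Lean document; each statement's English description precedes it below -/
import Mathlib

section
/- If either (d ≥ 3 and L ≥ 3) or (d = 2 and L ≥ 4), then C(L+d−1, d−1) < (1/L)·∑_{i=0}^{L−1} d^{gcd(i,L)} (with gcd(0,L) = L); that is, the dimension of the permutationally symmetric subspace 𝒮 is strictly smaller than the dimension of the translationally symmetric subspace 𝒯. Moreover, if (d = 2 and L ≤ 3) or L ≤ 2, the two dimensions are equal. -/
open scoped BigOperators

noncomputable section

/-- Cyclic shift by one site: `(shift σ) i = σ (i - 1)`. -/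
def shift (d L : ℕ) (σ : ZMod L → Fin d) : ZMod L → Fin d := fun i => σ (i - 1)

/-- The translation operator `T` on `H = (ℂ^d)^{⊗L}`. -/
def Tmat (d L : ℕ) [NeZero L] : Matrix (ZMod L → Fin d) (ZMod L → Fin d) ℂ :=
  Matrix.of fun τ σ => if τ = shift d L σ then 1 else 0

/-- The translationally symmetric subspace `𝒯 = {ψ : T ψ = ψ}`. -/
def transSym (d L : ℕ) [NeZero L] : Submodule ℂ ((ZMod L → Fin d) → ℂ) where
  carrier := {ψ | (Tmat d L).mulVec ψ = ψ}
  add_mem' := by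
    intro f g hf hg
    simp only [Set.mem_setOf_eq] at *
    simp [Matrix.mulVec_add, hf, hg]
  zero_mem' := by simp [Set.mem_setOf_eq, Matrix.mulVec_zero]
  smul_mem' := by
    intro c f hf
    simp only [Set.mem_setOf_eq] at *
    simp [Matrix.mulVec_smul, hf]

/-- The permutationally symmetric subspace `𝒮`. -/
def permSym (d L : ℕ) : Submodule ℂ ((ZMod L → Fin d) → ℂ) where
  carrier := {ψ | ∀ π : Equiv.Perm (ZMod L), ∀ σ, ψ (σ ∘ π) = ψ σ}
  add_mem' := by
    intro f g hf hg π σ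
    simp [hf π σ, hg π σ]
  zero_mem' := by intro π σ; rfl
  smul_mem' := by
    intro c f hf π σ
    simp [hf π σ]

/-- The functions constant on the fibres of a surjection onto a finite type `Y` form a space of
dimension `card Y`. -/
theorem finrank_eq_card_of_mem_iff_constant_on_fibers {X Y : Type*} [Fintype Y] (q : X → Y)
    (hq : Function.Surjective q) (W : Submodule ℂ (X → ℂ))
    (hW : ∀ f, f ∈ W ↔ ∀ x y, q x = q y → f x = f y) :
    Module.finrank ℂ W = Fintype.card Y := by
  have hrange : W = LinearMap.range (LinearMap.funLeft ℂ ℂ q) := by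
    ext f
    rw [hW, LinearMap.mem_range]
    constructor
    · intro h
      refine ⟨fun y => f (Function.surjInv hq y), ?_⟩
      ext x
      exact h _ _ (Function.surjInv_eq hq (q x))
    · rintro ⟨g, rfl⟩ x y hxy
      simp [LinearMap.funLeft_apply, hxy]
  rw [hrange, LinearMap.finrank_range_of_inj (LinearMap.funLeft_injective_of_surjective ℂ ℂ q hq),
    Module.finrank_fintype_fun_eq_card]

theorem exists_perm_of_map_univ_eq {ι α : Type*} [Fintype ι] [DecidableEq α] (σ τ : ι → α)
    (h : Finset.univ.val.map σ = Finset.univ.val.map τ) :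
    ∃ π : Equiv.Perm ι, τ ∘ π = σ := by
  have hcard : ∀ a, Nonempty ({i // σ i = a} ≃ {i // τ i = a}) := by
    intro a
    have ha := congrArg (Multiset.count a) h
    rw [Multiset.count_map, Multiset.count_map] at ha
    refine Fintype.card_eq.1 ?_
    rw [Fintype.card_subtype, Fintype.card_subtype, Finset.card_def, Finset.card_def]
    simpa [Finset.filter_val, eq_comm] using ha
  let e := fun a => (hcard a).some
  exact ⟨Equiv.ofFiberEquiv e, funext fun i => Equiv.ofFiberEquiv_map e i⟩

theorem finrank_permSym (d L : ℕ) [NeZero L] :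
    Module.finrank ℂ (permSym d L) = (d + L - 1).choose L := by
  let q : (ZMod L → Fin d) → Sym (Fin d) L := fun σ =>
    ⟨Finset.univ.val.map σ, by simp [ZMod.card]⟩
  have hq : Function.Surjective q := by
    rintro ⟨m, hm⟩
    induction m using Quotient.inductionOn with
    | h l =>
      obtain rfl : l.length = L := by simpa using hm
      let e : ZMod l.length ≃ Fin l.length := Fintype.equivFinOfCardEq (ZMod.card _)
      refine ⟨l.get ∘ e, Subtype.ext ?_⟩
      change Finset.univ.val.map (l.get ∘ e) = (l : Multiset (Fin d))
      rw [← Multiset.map_map, Multiset.map_univ_val_equiv, Fin.univ_val_map, List.ofFn_get]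
  rw [finrank_eq_card_of_mem_iff_constant_on_fibers q hq, Sym.card_sym_eq_choose,
    Fintype.card_fin]
  intro f
  constructor
  · intro hf σ τ h
    obtain ⟨π, rfl⟩ := exists_perm_of_map_univ_eq σ τ (congrArg Subtype.val h)
    exact hf π τ
  · intro hf π σ
    refine hf _ _ (Subtype.ext ?_)
    change Finset.univ.val.map (σ ∘ π) = Finset.univ.val.map σ
    rw [← Multiset.map_map, Multiset.map_univ_val_equiv]

theorem mem_transSym_iff_shift (d L : ℕ) [NeZero L] (ψ : (ZMod L → Fin d) → ℂ) :
    ψ ∈ transSym d L ↔ ∀ σ, ψ (shift d L σ) = ψ σ := by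
  have hinj : Function.Injective (shift d L) := by
    intro σ τ h
    ext i
    simpa [shift] using congrArg Fin.val (congrFun h (i + 1))
  have happly : ∀ σ, (Tmat d L).mulVec ψ (shift d L σ) = ψ σ := by
    intro σ
    simp [Matrix.mulVec, dotProduct, Tmat, hinj.eq_iff]
  change (Tmat d L).mulVec ψ = ψ ↔ _
  constructor
  · intro h σ
    rw [← happly σ, h]
  · intro h
    ext τ
    have hτ : τ = shift d L (fun i => τ (i + 1)) := by
      ext i
      simp [shift]
    rw [hτ, happly, h]

theorem mem_transSym_iff (d L : ℕ) [NeZero L] (ψ : (ZMod L → Fin d) → ℂ) :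
    ψ ∈ transSym d L ↔ ∀ (k : ZMod L) σ, ψ (fun i => σ (i - k)) = ψ σ := by
  rw [mem_transSym_iff_shift]
  refine ⟨fun h k => ?_, fun h => h 1⟩
  suffices ∀ (n : ℕ) σ, ψ (fun i => σ (i - n)) = ψ σ by
    simpa using this k.val
  intro n
  induction n with
  | zero => simp
  | succ n ih =>
    intro σ
    rw [← ih σ, ← h (fun i => σ (i - n))]
    congr 1
    ext i
    simp only [shift, Nat.cast_succ]
    congr 2
    ring

/-- The translation action of `ZMod L` on configurations. -/
@[reducible] def translationAction (d L : ℕ) : AddAction (ZMod L) (ZMod L → Fin d) where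
  vadd k σ := fun i => σ (i - k)
  zero_vadd σ := by
    funext i
    change σ (i - 0) = σ i
    rw [sub_zero]
  add_vadd k l σ := by
    funext i
    change σ (i - (k + l)) = σ (i - k - l)
    rw [sub_sub]

theorem card_translation_fixed (d L : ℕ) [NeZero L] (k : ZMod L) :
    Nat.card {σ : ZMod L → Fin d // (fun i => σ (i - k)) = σ} = d ^ Nat.gcd k.val L := by
  let H := AddSubgroup.zmultiples k
  have hmem : ∀ σ : ZMod L → Fin d, (fun i => σ (i - k)) = σ →
      ∀ h ∈ H, ∀ i, σ (i + h) = σ i := by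
    intro σ hσ
    let S : AddSubgroup (ZMod L) :=
      { carrier := {h | ∀ i, σ (i + h) = σ i}
        zero_mem' := by intro i; rw [add_zero]
        add_mem' := by
          intro a b ha hb i
          rw [← add_assoc, hb, ha]
        neg_mem' := by
          intro a ha i
          rw [← ha (i + -a), neg_add_cancel_right] }
    have hk : k ∈ S := by
      intro i
      simpa using (congrFun hσ (i + k)).symm
    exact AddSubgroup.zmultiples_le_of_mem hk
  let e : {σ : ZMod L → Fin d // (fun i => σ (i - k)) = σ} ≃ (ZMod L ⧸ H → Fin d) :=
    { toFun := fun σ x => Quotient.liftOn' x σ.1 (by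
        intro a b hab
        rw [QuotientAddGroup.leftRel_apply] at hab
        simpa using (hmem σ.1 σ.2 _ hab a).symm)
      invFun := fun f => ⟨fun i => f (QuotientAddGroup.mk i), by
        funext i
        refine congrArg f ?_
        rw [QuotientAddGroup.eq]
        simp [H]⟩
      left_inv := fun σ => rfl
      right_inv := fun f => by
        funext x
        induction x using QuotientAddGroup.induction_on with
        | H z => rfl }
  rw [Nat.card_congr e, Nat.card_fun, Nat.card_fin]
  congr 1
  have hcard := H.card_eq_card_quotient_mul_card_addSubgroup
  have horder : addOrderOf k = L / L.gcd k.val := by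
    conv_lhs => rw [← ZMod.natCast_zmod_val k]
    exact ZMod.addOrderOf_coe _ (NeZero.ne L)
  rw [Nat.card_zmod, Nat.card_zmultiples, horder] at hcard
  have hdvd := Nat.gcd_dvd_left L k.val
  have hL := Nat.pos_of_ne_zero (NeZero.ne L)
  have hpos : 0 < L / L.gcd k.val :=
    Nat.div_pos (Nat.le_of_dvd hL hdvd) (Nat.gcd_pos_of_pos_left _ hL)
  rw [Nat.gcd_comm]
  refine Nat.eq_of_mul_eq_mul_right hpos ?_
  rw [← hcard, Nat.mul_div_cancel' hdvd]

theorem finrank_transSym_mul (d L : ℕ) [NeZero L] :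
    Module.finrank ℂ (transSym d L) * L = ∑ i ∈ Finset.range L, d ^ Nat.gcd i L := by
  classical
  let := translationAction d L
  let : Fintype (Quotient (AddAction.orbitRel (ZMod L) (ZMod L → Fin d))) := Fintype.ofFinite _
  have hfin : Module.finrank ℂ (transSym d L) =
      Fintype.card (Quotient (AddAction.orbitRel (ZMod L) (ZMod L → Fin d))) := by
    refine finrank_eq_card_of_mem_iff_constant_on_fibers (Quotient.mk _) Quotient.mk_surjective _ ?_
    intro f
    rw [mem_transSym_iff]
    constructor
    · intro hf σ τ h
      obtain ⟨k, rfl⟩ := Quotient.exact h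
      exact hf k τ
    · intro hf k σ
      exact hf _ _ (Quotient.sound ⟨k, rfl⟩)
  have hburnside :=
    AddAction.sum_card_fixedBy_eq_card_orbits_mul_card_addGroup (ZMod L) (ZMod L → Fin d)
  rw [ZMod.card, ← hfin] at hburnside
  rw [← hburnside]
  have hfix : ∀ k : ZMod L, Fintype.card (AddAction.fixedBy (ZMod L → Fin d) k) =
      d ^ Nat.gcd k.val L := by
    intro k
    rw [← Nat.card_eq_fintype_card]
    exact card_translation_fixed d L k
  simp_rw [hfix]
  refine Finset.sum_bij' (fun k _ => k.val) (fun i _ => (i : ZMod L)) ?_ ?_ ?_ ?_ ?_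
  · intro k _
    exact Finset.mem_range.2 (ZMod.val_lt k)
  · intro i _
    exact Finset.mem_univ _
  · intro k _
    exact ZMod.natCast_zmod_val k
  · intro i hi
    exact ZMod.val_cast_of_lt (Finset.mem_range.1 hi)
  · intro k _
    rfl

theorem permSym_le_transSym (d L : ℕ) [NeZero L] : permSym d L ≤ transSym d L := by
  intro ψ hψ
  rw [mem_transSym_iff]
  intro k σ
  exact hψ (Equiv.subRight k) σ

theorem permSym_lt_transSym (d L : ℕ) [NeZero L] (σ : ZMod L → Fin d)
    (π : Equiv.Perm (ZMod L)) (h : ∀ k, σ ∘ π ≠ fun i => σ (i - k)) :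
    permSym d L < transSym d L := by
  classical
  refine lt_of_le_of_ne (permSym_le_transSym d L) fun heq => ?_
  let ψ : (ZMod L → Fin d) → ℂ := fun τ => if ∃ k, τ = fun i => σ (i - k) then 1 else 0
  have hψ : ψ ∈ transSym d L := by
    rw [mem_transSym_iff]
    intro k τ
    refine if_congr ⟨?_, ?_⟩ rfl rfl
    · rintro ⟨l, hl⟩
      refine ⟨l - k, funext fun i => ?_⟩
      have := congrFun hl (i + k)
      simp only [add_sub_cancel_right] at this
      rw [this]
      congr 1
      ring
    · rintro ⟨l, rfl⟩
      refine ⟨k + l, funext fun i => ?_⟩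
      simp only [sub_sub]
  rw [← heq] at hψ
  have h1 := hψ π σ
  have h2 : ψ σ = 1 := if_pos ⟨0, by simp⟩
  have h3 : ψ (σ ∘ π) = 0 := if_neg (by simpa using h)
  rw [h2, h3] at h1
  exact zero_ne_one h1

theorem natCast_zmod_ne_zero {L n : ℕ} (hn : 0 < n) (h : n < L) : (n : ZMod L) ≠ 0 := by
  rw [Ne, ZMod.natCast_eq_zero_iff]
  exact Nat.not_dvd_of_pos_of_lt hn h

theorem permSym_lt_transSym_of_three_le (d L : ℕ) [NeZero L] (hd : 3 ≤ d) (hL : 3 ≤ L) :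
    permSym d L < transSym d L := by
  have h1 : (1 : ZMod L) ≠ 0 := by
    exact_mod_cast natCast_zmod_ne_zero (n := 1) (by omega) (by omega)
  have h2 : (2 : ZMod L) ≠ 0 := by
    exact_mod_cast natCast_zmod_ne_zero (n := 2) (by omega) (by omega)
  let σ : ZMod L → Fin d := fun i =>
    if i = 0 then ⟨1, by omega⟩ else if i = 1 then ⟨2, by omega⟩ else ⟨0, by omega⟩
  have hσ1 : ∀ i, (σ i).val = 1 → i = 0 := by
    intro i
    simp only [σ]
    split_ifs <;> simp_all
  have hσ2 : ∀ i, (σ i).val = 2 → i = 1 := by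
    intro i
    simp only [σ]
    split_ifs <;> simp_all
  refine permSym_lt_transSym d L σ (Equiv.swap 0 1) fun k hk => ?_
  have e0 := hσ2 (0 - k) (by
    rw [← congrFun hk 0]
    simp [σ, h1])
  have e1 := hσ1 (1 - k) (by
    rw [← congrFun hk 1]
    simp [σ])
  exact h2 (by linear_combination e1 - e0)

theorem permSym_lt_transSym_of_four_le (d L : ℕ) [NeZero L] (hd : 2 ≤ d) (hL : 4 ≤ L) :
    permSym d L < transSym d L := by
  have h1 : (1 : ZMod L) ≠ 0 := by
    exact_mod_cast natCast_zmod_ne_zero (n := 1) (by omega) (by omega)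
  have h2 : (2 : ZMod L) ≠ 0 := by
    exact_mod_cast natCast_zmod_ne_zero (n := 2) (by omega) (by omega)
  have h3 : (3 : ZMod L) ≠ 0 := by
    exact_mod_cast natCast_zmod_ne_zero (n := 3) (by omega) (by omega)
  let σ : ZMod L → Fin d := fun i =>
    if i = 0 ∨ i = 1 then ⟨1, by omega⟩ else ⟨0, by omega⟩
  have hσ : ∀ i, (σ i).val = 1 → i = 0 ∨ i = 1 := by
    intro i
    simp only [σ]
    split_ifs <;> simp_all
  refine permSym_lt_transSym d L σ (Equiv.swap 1 2) fun k hk => ?_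
  have e0 := hσ (0 - k) (by
    rw [← congrFun hk 0, Function.comp_apply, Equiv.swap_apply_of_ne_of_ne h1.symm h2.symm]
    simp [σ])
  have e2 := hσ (2 - k) (by
    rw [← congrFun hk 2, Function.comp_apply, Equiv.swap_apply_right]
    simp [σ])
  rcases e0 with e0 | e0 <;> rcases e2 with e2 | e2
  · exact h2 (by linear_combination e2 - e0)
  · exact h1 (by linear_combination e2 - e0)
  · exact h3 (by linear_combination e2 - e0)
  · exact h2 (by linear_combination e2 - e0)

theorem permSym_eq_transSym (d L : ℕ) [NeZero L]
    (h : ∀ (σ : ZMod L → Fin d) (π : Equiv.Perm (ZMod L)), ∃ k, ∀ i, σ (π i) = σ (i - k)) :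
    permSym d L = transSym d L := by
  refine le_antisymm (permSym_le_transSym d L) fun ψ hψ π σ => ?_
  rw [mem_transSym_iff] at hψ
  obtain ⟨k, hk⟩ := h σ π
  rw [← hψ k σ]
  exact congrArg ψ (funext hk)

/-- if `(d ≥ 3 and L ≥ 3)` or `(d = 2 and L ≥ 4)`, then
`C(L+d−1, d−1) < (1/L)·∑_{i=0}^{L−1} d^{gcd(i,L)}`, i.e. `dim 𝒮 < dim 𝒯`.
Moreover, if `(d = 2 and L ≤ 3)` or `L ≤ 2`, the two dimensions are equal. -/
theorem stmt4 (d L : ℕ) [NeZero L] (hd : 2 ≤ d) (hL : 1 ≤ L) :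
    (((3 ≤ d ∧ 3 ≤ L) ∨ (d = 2 ∧ 4 ≤ L)) →
      (((L + d - 1).choose (d - 1) : ℚ)
          < (1 / L) * ∑ i ∈ Finset.range L, (d : ℚ) ^ Nat.gcd i L) ∧
      Module.finrank ℂ (permSym d L) < Module.finrank ℂ (transSym d L)) ∧
    (((d = 2 ∧ L ≤ 3) ∨ L ≤ 2) →
      Module.finrank ℂ (permSym d L) = Module.finrank ℂ (transSym d L)) := by
  refine ⟨fun h => ?_, fun h => ?_⟩
  · have hlt : permSym d L < transSym d L := by
      rcases h with ⟨h3, h4⟩ | ⟨h3, h4⟩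
      · exact permSym_lt_transSym_of_three_le d L h3 h4
      · exact permSym_lt_transSym_of_four_le d L hd h4
    have hfin := Submodule.finrank_lt_finrank_of_lt hlt
    refine ⟨?_, hfin⟩
    have hLpos : (0 : ℚ) < L := by exact_mod_cast hL
    have hchoose : (L + d - 1).choose (d - 1) = Module.finrank ℂ (permSym d L) := by
      rw [finrank_permSym, add_comm L d]
      exact Nat.choose_symm_of_eq_add (by omega)
    have hsum : (∑ i ∈ Finset.range L, (d : ℚ) ^ Nat.gcd i L) =
        Module.finrank ℂ (transSym d L) * L := by
      exact_mod_cast (finrank_transSym_mul d L).symm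
    rw [hchoose, hsum, mul_comm, mul_one_div, mul_div_cancel_right₀ _ hLpos.ne']
    exact_mod_cast hfin
  · rw [permSym_eq_transSym]
    have hperm2 : ∀ π : Equiv.Perm (ZMod 2), ∃ k, ∀ i, π i = i - k := by decide
    have hsmall : L = 1 ∨ L = 2 ∨ (L = 3 ∧ d = 2) := by omega
    rcases hsmall with rfl | rfl | ⟨rfl, rfl⟩
    · exact fun σ π => ⟨0, fun i => congrArg σ (Subsingleton.elim (α := Fin 1) _ _)⟩
    · intro σ π
      obtain ⟨k, hk⟩ := hperm2 π
      exact ⟨k, fun i => congrArg σ (hk i)⟩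
    · change ∀ (σ : Fin 3 → Fin 2) (π : Equiv.Perm (Fin 3)), ∃ k, ∀ i, σ (π i) = σ (i - k)
      decide
end
end

section
/- The maximally mixed invariant state of permutation symmetry, ρ_𝒮 = P_𝒮 / Tr(P_𝒮), is fully separable: there exist finitely many unit vectors ψ_α ∈ ℂ^d and probabilities p_α ≥ 0 with ∑_α p_α = 1 such that ρ_𝒮 = ∑_α p_α (|ψ_α⟩⟨ψ_α|)^{⊗L}. -/
open scoped BigOperators

noncomputable section

/-- The `L`-fold tensor (Kronecker) power `(|ψ⟩⟨ψ|)^{⊗L}` of the rank-one projection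
onto `ψ ∈ ℂ^d`, with matrix entries `∏_i ψ(τ_i) · conj(∏_i ψ(σ_i))`. -/
def pureTensorPow (d L : ℕ) [NeZero L] (ψ : Fin d → ℂ) :
    Matrix (ZMod L → Fin d) (ZMod L → Fin d) ℂ :=
  Matrix.of fun τ σ => (∏ i, ψ (τ i)) * (starRingEnd ℂ) (∏ i, ψ (σ i))

theorem hermitian_pow_apply_self {n : Type*} [Fintype n] [DecidableEq n] {A : Matrix n n ℝ}
    (hA : A.IsHermitian) (k : ℕ) (j : n) :
    (A ^ k) j j = ∑ i, (hA.eigenvectorUnitary : Matrix n n ℝ) j i ^ 2 * hA.eigenvalues i ^ k := by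
  conv_lhs => rw [hA.spectral_theorem, ← map_pow, Unitary.conjStarAlgAut_apply,
    Matrix.diagonal_pow, Matrix.mul_apply]
  refine Finset.sum_congr rfl fun i _ => ?_
  simp [Matrix.mul_diagonal, Matrix.star_apply]
  ring

/-- Cholesky factor of the truncated Jacobi matrix of the Laguerre polynomials. -/
def laguerreFactor (N : ℕ) : Matrix (Fin N) (Fin N) ℝ :=
  Matrix.of fun m n => √((m : ℝ) + 1) *
    ((if (n : ℕ) = m then 1 else 0) + (if (n : ℕ) = m + 1 then 1 else 0))

theorem sum_fin_ite_eq {N : ℕ} (j : ℕ) (f : ℕ → ℝ) (hf : N ≤ j → f j = 0) :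
    ∑ n : Fin N, (if (n : ℕ) = j then 1 else 0) * f n = f j := by
  rw [Fin.sum_univ_eq_sum_range (fun n => (if n = j then 1 else 0) * f n) N]
  simp only [ite_mul, one_mul, zero_mul, Finset.sum_ite_eq', Finset.mem_range]
  split_ifs with h
  · rfl
  · exact (hf (not_lt.mp h)).symm

theorem laguerreFactor_mulVec (N k : ℕ) (hk : k < N) :
    (laguerreFactor N).mulVec (fun n : Fin N => (k.choose n : ℝ)) =
      fun m : Fin N => √((m : ℝ) + 1) * ((k + 1).choose (m + 1) : ℝ) := by
  ext m
  simp only [Matrix.mulVec, dotProduct, laguerreFactor, Matrix.of_apply, mul_assoc, add_mul,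
    ← Finset.mul_sum, Finset.sum_add_distrib]
  have h0 := sum_fin_ite_eq (N := N) m (fun n => (k.choose n : ℝ)) (fun h => by omega)
  have h1 := sum_fin_ite_eq (N := N) (m + 1) (fun n => (k.choose n : ℝ))
    (fun h => by rw [Nat.choose_eq_zero_of_lt (by omega)]; simp)
  rw [h0, h1, Nat.choose_succ_succ]
  push_cast
  rfl

theorem laguerreFactor_transpose_mulVec (N k : ℕ) :
    (laguerreFactor N).transpose.mulVec
      (fun m : Fin N => √((m : ℝ) + 1) * ((k + 1).choose (m + 1) : ℝ)) =
      fun n : Fin N => ((k : ℝ) + 1) * ((k + 1).choose n : ℝ) := by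
  ext n
  have key (m : ℕ) : √((m : ℝ) + 1) * (√((m : ℝ) + 1) * ((k + 1).choose (m + 1) : ℝ)) =
      ((k : ℝ) + 1) * k.choose m := by
    rw [← mul_assoc, Real.mul_self_sqrt (by positivity)]
    have := Nat.add_one_mul_choose_eq k m
    have h : ((k : ℝ) + 1) * k.choose m = (k + 1).choose (m + 1) * ((m : ℝ) + 1) := by
      exact_mod_cast this
    rw [h]; ring
  simp only [Matrix.mulVec, dotProduct, laguerreFactor, Matrix.of_apply, Matrix.transpose_apply]
  have e (m : Fin N) : √((m : ℝ) + 1) *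
      ((if (n : ℕ) = m then 1 else 0) + (if (n : ℕ) = m + 1 then 1 else 0)) *
        (√((m : ℝ) + 1) * ((k + 1).choose (m + 1) : ℝ)) =
      ((k : ℝ) + 1) * ((if (m : ℕ) = n then 1 else 0) * (k.choose m : ℝ)) +
      ((k : ℝ) + 1) * ((if (n : ℕ) = m + 1 then 1 else 0) * (k.choose m : ℝ)) := by
    rw [mul_right_comm, key]
    simp only [eq_comm (a := (n : ℕ)) (b := (m : ℕ))]
    ring
  simp only [e, Finset.sum_add_distrib, ← Finset.mul_sum]
  rw [sum_fin_ite_eq (N := N) n (fun n => (k.choose n : ℝ)) (fun h => by omega)]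
  obtain ⟨n, hn⟩ := n
  cases n with
  | zero => simp
  | succ n =>
    simp only [Nat.add_right_cancel_iff, eq_comm (a := n)]
    rw [sum_fin_ite_eq (N := N) n (fun n => (k.choose n : ℝ)) (fun h => by omega),
      Nat.choose_succ_succ]
    push_cast
    ring

/-- A finite positive quadrature rule reproducing the moments of the exponential distribution. -/
theorem exists_factorial_quadrature (L : ℕ) :
    ∃ w t : Fin (L + 1) → ℝ, (∀ i, 0 ≤ w i) ∧ (∀ i, 0 ≤ t i) ∧
      ∀ k ≤ L, ∑ i, w i * t i ^ k = (k.factorial : ℝ) := by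
  set B := laguerreFactor (L + 1)
  have hpos : (B.conjTranspose * B).PosSemidef := Matrix.posSemidef_conjTranspose_mul_self B
  have hpow : ∀ k ≤ L, ((B.conjTranspose * B) ^ k).mulVec (Pi.single 0 1) =
      fun n : Fin (L + 1) => (k.factorial : ℝ) * k.choose n := by
    intro k
    induction k with
    | zero =>
      intro _
      ext n
      refine Fin.cases ?_ (fun n => ?_) n <;> simp
    | succ k ih =>
      intro hk
      rw [pow_succ', ← Matrix.mulVec_mulVec, ih (by omega)]
      have : (fun n : Fin (L + 1) => (k.factorial : ℝ) * k.choose n) =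
          (k.factorial : ℝ) • fun n : Fin (L + 1) => (k.choose n : ℝ) := by
        ext; simp
      rw [this, Matrix.mulVec_smul, ← Matrix.mulVec_mulVec,
        laguerreFactor_mulVec _ _ (by omega : k < L + 1), Matrix.conjTranspose_eq_transpose_of_trivial,
        laguerreFactor_transpose_mulVec]
      ext n
      simp [Nat.factorial_succ]
      ring
  refine ⟨fun i => (hpos.isHermitian.eigenvectorUnitary : Matrix (Fin (L + 1)) (Fin (L + 1)) ℝ) 0 i ^ 2,
    hpos.isHermitian.eigenvalues, fun i => sq_nonneg _, hpos.eigenvalues_nonneg, fun k hk => ?_⟩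
  rw [← hermitian_pow_apply_self]
  have := congrFun (hpow k hk) 0
  simpa [Matrix.mulVec_single] using this

theorem IsPrimitiveRoot.sum_pow_mul_conj_pow {N : ℕ} {ζ : ℂ} (hζ : IsPrimitiveRoot ζ N)
    {a b : ℕ} (ha : a < N) (hb : b < N) :
    ∑ j : Fin N, (ζ ^ (j : ℕ)) ^ a * (starRingEnd ℂ) ((ζ ^ (j : ℕ)) ^ b) =
      if a = b then (N : ℂ) else 0 := by
  have hN : N ≠ 0 := by omega
  have hc : ζ * (starRingEnd ℂ) ζ = 1 := by
    rw [Complex.mul_conj, Complex.normSq_eq_norm_sq, hζ.norm'_eq_one hN]; simp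
  have hterm (j : ℕ) : (ζ ^ j) ^ a * (starRingEnd ℂ) ((ζ ^ j) ^ b) =
      (ζ ^ a * (starRingEnd ℂ) ζ ^ b) ^ j := by
    simp only [map_pow, mul_pow, ← pow_mul, mul_comm j]
  simp only [hterm]
  rw [Fin.sum_univ_eq_sum_range (fun j => (ζ ^ a * (starRingEnd ℂ) ζ ^ b) ^ j) N]
  split_ifs with h
  · subst h
    simp [← mul_pow, hc]
  · have hne : ζ ^ a * (starRingEnd ℂ) ζ ^ b ≠ 1 := by
      intro h1
      apply h
      apply hζ.pow_inj ha hb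
      calc ζ ^ a = ζ ^ a * (ζ * (starRingEnd ℂ) ζ) ^ b := by rw [hc]; simp
        _ = ζ ^ a * (starRingEnd ℂ) ζ ^ b * ζ ^ b := by rw [mul_pow]; ring
        _ = ζ ^ b := by rw [h1, one_mul]
    rw [geom_sum_eq hne]
    have : (ζ ^ a * (starRingEnd ℂ) ζ ^ b) ^ N = 1 := by
      rw [mul_pow, ← pow_mul, ← pow_mul, mul_comm a, mul_comm b, pow_mul, pow_mul, ← map_pow,
        hζ.pow_eq_one]
      simp
    simp [this]

/-- A finitely supported positive measure on `ℂ` with the mixed moments of a standard complex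
Gaussian up to degree `L`. -/
theorem exists_complex_gaussian_quadrature (L : ℕ) :
    ∃ (w : Fin (L + 1) × Fin (L + 1) → ℝ) (z : Fin (L + 1) × Fin (L + 1) → ℂ), (∀ i, 0 ≤ w i) ∧
      ∀ a ≤ L, ∀ b ≤ L, ∑ i, (w i : ℂ) * (z i ^ a * (starRingEnd ℂ) (z i ^ b)) =
        if a = b then (a.factorial : ℂ) else 0 := by
  obtain ⟨w, t, hw, ht, hm⟩ := exists_factorial_quadrature L
  obtain ⟨ζ, hζ⟩ : ∃ ζ : ℂ, IsPrimitiveRoot ζ (L + 1) :=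
    ⟨_, Complex.isPrimitiveRoot_exp (L + 1) (by omega)⟩
  refine ⟨fun i => w i.1 / (L + 1), fun i => (√(t i.1) : ℂ) * ζ ^ (i.2 : ℕ),
    fun i => div_nonneg (hw _) (by positivity), fun a ha b hb => ?_⟩
  have hL : (L : ℂ) + 1 ≠ 0 := by exact_mod_cast L.succ_ne_zero
  calc _ = (∑ i, (w i : ℂ) * (√(t i) : ℂ) ^ (a + b)) * (((L : ℂ) + 1)⁻¹ *
        ∑ j : Fin (L + 1), (ζ ^ (j : ℕ)) ^ a * (starRingEnd ℂ) ((ζ ^ (j : ℕ)) ^ b)) := by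
        rw [Fintype.sum_prod_type, Finset.mul_sum, Finset.sum_mul_sum]
        refine Finset.sum_congr rfl fun i _ => Finset.sum_congr rfl fun j _ => ?_
        simp only [mul_pow, map_mul, map_pow, Complex.conj_ofReal]
        push_cast
        ring
    _ = _ := by
        rw [hζ.sum_pow_mul_conj_pow (by omega) (by omega)]
        split_ifs with h
        · subst h
          push_cast
          rw [inv_mul_cancel₀ hL, mul_one, ← Complex.ofReal_natCast, ← hm a ha]
          push_cast
          refine Finset.sum_congr rfl fun i _ => ?_
          rw [← two_mul, pow_mul, ← Complex.ofReal_pow √(t i), Real.sq_sqrt (ht i)]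
        · simp

theorem prod_comp_eq_prod_pow {ι κ M : Type*} [Fintype ι] [Fintype κ] [DecidableEq κ]
    [CommMonoid M] (f : κ → M) (τ : ι → κ) :
    ∏ i, f (τ i) = ∏ q, f q ^ Fintype.card {i // τ i = q} := by
  rw [← Finset.prod_fiberwise' Finset.univ τ f]
  simp [Fintype.card_subtype]

/-- The number of permutations carrying a colouring `τ` to a colouring `σ`. -/
theorem card_perm_comp_eq {ι κ : Type*} [Fintype ι] [DecidableEq ι] [Fintype κ] [DecidableEq κ]
    (τ σ : ι → κ) :
    Fintype.card {π : Equiv.Perm ι // τ ∘ π = σ} =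
      ∏ q, if Fintype.card {i // τ i = q} = Fintype.card {i // σ i = q} then
        (Fintype.card {i // τ i = q}).factorial else 0 := by
  by_cases h : ∀ q, Fintype.card {i // τ i = q} = Fintype.card {i // σ i = q}
  · simp only [h, if_true]
    let e : Equiv.Perm ι := Equiv.ofFiberEquiv fun q => Fintype.equivOfCardEq (h q).symm
    have he : τ ∘ e = σ := funext fun i => Equiv.ofFiberEquiv_map _ i
    rw [← DomMulAct.stabilizer_card σ]
    refine Fintype.card_congr ((Equiv.mulLeft e⁻¹).subtypeEquiv fun π => ?_)
    have : σ ∘ ⇑(e⁻¹ * π) = τ ∘ π := by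
      rw [← he]; ext i; simp
    simp only [Equiv.coe_mulLeft, this]
  · obtain ⟨q, hq⟩ := not_forall.mp h
    rw [Finset.prod_eq_zero (Finset.mem_univ q) (if_neg hq), Fintype.card_eq_zero_iff]
    refine ⟨fun ⟨π, hπ⟩ => hq ?_⟩
    refine (Fintype.card_congr (π.subtypeEquiv fun i => ?_)).symm
    rw [← hπ]; rfl

/-- The matrix of `∑_π P_π`. -/
def permSum (d L : ℕ) [NeZero L] : Matrix (ZMod L → Fin d) (ZMod L → Fin d) ℂ :=
  Matrix.of fun τ σ => (Fintype.card {π : Equiv.Perm (ZMod L) // τ ∘ π = σ} : ℂ)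

theorem permSum_eq_sum_pureTensorPow (d L : ℕ) [NeZero L] :
    ∃ (κ : Type) (_ : Fintype κ) (w : κ → ℝ) (ψ : κ → Fin d → ℂ), (∀ i, 0 ≤ w i) ∧
      permSum d L = ∑ i, (w i : ℂ) • pureTensorPow d L (ψ i) := by
  obtain ⟨w, z, hw, hm⟩ := exists_complex_gaussian_quadrature L
  refine ⟨Fin d → Fin (L + 1) × Fin (L + 1), inferInstance, fun f => ∏ q, w (f q),
    fun f q => z (f q), fun f => Finset.prod_nonneg fun q _ => hw _, ?_⟩
  ext τ σ
  have hcard (τ : ZMod L → Fin d) (q : Fin d) : Fintype.card {i // τ i = q} ≤ L :=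
    (Fintype.card_subtype_le _).trans (ZMod.card L).le
  simp only [permSum, pureTensorPow, Matrix.of_apply, Matrix.sum_apply, Matrix.smul_apply,
    card_perm_comp_eq, smul_eq_mul]
  push_cast
  simp only [← hm _ (hcard τ _) _ (hcard σ _)]
  rw [Finset.prod_univ_sum, Fintype.piFinset_univ]
  refine Finset.sum_congr rfl fun f _ => ?_
  rw [prod_comp_eq_prod_pow (fun q => z (f q)) τ, prod_comp_eq_prod_pow (fun q => z (f q)) σ,
    map_prod, ← Finset.prod_mul_distrib, ← Finset.prod_mul_distrib]

theorem permSum_mulVec (d L : ℕ) [NeZero L] (v : (ZMod L → Fin d) → ℂ) (τ : ZMod L → Fin d) :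
    (permSum d L).mulVec v τ = ∑ π : Equiv.Perm (ZMod L), v (τ ∘ π) := by
  simp only [Matrix.mulVec, dotProduct, permSum, Matrix.of_apply]
  rw [← Finset.sum_fiberwise' Finset.univ (fun π : Equiv.Perm (ZMod L) => τ ∘ π) v]
  simp [Fintype.card_subtype]

theorem permSum_mulVec_mem (d L : ℕ) [NeZero L] (v : (ZMod L → Fin d) → ℂ) :
    (permSum d L).mulVec v ∈ permSym d L := by
  intro π σ
  rw [permSum_mulVec, permSum_mulVec]
  exact Fintype.sum_equiv (Equiv.mulLeft π) _ _ fun ρ => rfl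

theorem permSum_mulVec_of_mem {d L : ℕ} [NeZero L] {v : (ZMod L → Fin d) → ℂ}
    (hv : v ∈ permSym d L) : (permSum d L).mulVec v = (L.factorial : ℂ) • v := by
  ext τ
  rw [permSum_mulVec, Finset.sum_congr rfl fun π _ => hv π τ]
  simp [Fintype.card_perm, ZMod.card]

theorem permSum_isHermitian (d L : ℕ) [NeZero L] : (permSum d L).IsHermitian := by
  ext τ σ
  simp only [permSum, Matrix.conjTranspose_apply, Matrix.of_apply, star_natCast, Nat.cast_inj]
  refine Fintype.card_congr ((Equiv.inv _).subtypeEquiv fun π => ?_)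
  constructor
  · rintro rfl; ext i; simp
  · rintro rfl; ext i; simp

/-- The orthogonal projector onto the symmetric subspace is the average of the permutation
operators. -/
theorem permSum_eq_smul_projector {d L : ℕ} [NeZero L]
    {P : Matrix (ZMod L → Fin d) (ZMod L → Fin d) ℂ} (hHerm : P.IsHermitian) (hIdem : P * P = P)
    (hRange : LinearMap.range P.mulVecLin = permSym d L) :
    permSum d L = (L.factorial : ℂ) • P := by
  have h1 : P * permSum d L = permSum d L := by
    refine Matrix.ext_of_mulVec_single fun i => ?_
    obtain ⟨u, hu⟩ : (permSum d L).mulVec (Pi.single i 1) ∈ LinearMap.range P.mulVecLin :=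
      hRange ▸ permSum_mulVec_mem d L _
    rw [← Matrix.mulVec_mulVec, ← hu, Matrix.mulVecLin_apply, Matrix.mulVec_mulVec, hIdem]
  have h2 : permSum d L * P = (L.factorial : ℂ) • P := by
    refine Matrix.ext_of_mulVec_single fun i => ?_
    rw [← Matrix.mulVec_mulVec, permSum_mulVec_of_mem (hRange ▸ ⟨Pi.single i 1, rfl⟩),
      Matrix.smul_mulVec]
  have h3 := congrArg Matrix.conjTranspose h2
  rw [Matrix.conjTranspose_mul, hHerm.eq, (permSum_isHermitian d L).eq, h1,
    Matrix.conjTranspose_smul, hHerm.eq] at h3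
  simpa using h3

theorem pureTensorPow_smul (d L : ℕ) [NeZero L] (c : ℝ) (ψ : Fin d → ℂ) :
    pureTensorPow d L ((c : ℂ) • ψ) = (((c ^ 2) ^ L : ℝ) : ℂ) • pureTensorPow d L ψ := by
  ext τ σ
  simp [pureTensorPow, Finset.prod_mul_distrib, ZMod.card]
  ring

theorem trace_pureTensorPow (d L : ℕ) [NeZero L] (ψ : Fin d → ℂ) :
    (pureTensorPow d L ψ).trace = (((∑ q, Complex.normSq (ψ q)) ^ L : ℝ) : ℂ) := by
  have h : (∑ q, Complex.normSq (ψ q)) ^ L = ∏ _i : ZMod L, ∑ q, Complex.normSq (ψ q) := by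
    simp [ZMod.card]
  rw [h, Finset.prod_univ_sum, Fintype.piFinset_univ]
  simp [Matrix.trace, pureTensorPow, Complex.mul_conj, ← Finset.prod_mul_distrib]

theorem exists_unit_pureTensorPow {d L : ℕ} [NeZero L] (hd : 0 < d) (ψ : Fin d → ℂ) :
    ∃ (c : ℝ) (φ : Fin d → ℂ), 0 ≤ c ∧ ∑ q, Complex.normSq (φ q) = 1 ∧
      pureTensorPow d L ψ = (c : ℂ) • pureTensorPow d L φ := by
  by_cases h : ψ = 0
  · refine ⟨0, Pi.single ⟨0, hd⟩ 1, le_rfl, ?_, ?_⟩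
    · rw [Finset.sum_eq_single ⟨0, hd⟩] <;> simp +contextual
    · ext τ σ
      simp [h, pureTensorPow, NeZero.ne L, ZMod.card]
  · set N := ∑ q, Complex.normSq (ψ q) with hN
    have hpos : 0 < N := by
      obtain ⟨q, hq⟩ := Function.ne_iff.mp h
      exact Finset.sum_pos' (fun _ _ => Complex.normSq_nonneg _)
        ⟨q, Finset.mem_univ q, Complex.normSq_pos.mpr hq⟩
    have hs : √N ≠ 0 := (Real.sqrt_pos.mpr hpos).ne'
    refine ⟨(√N ^ 2) ^ L, (((√N)⁻¹ : ℝ) : ℂ) • ψ, by positivity, ?_, ?_⟩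
    · simp only [Pi.smul_apply, smul_eq_mul, map_mul, Complex.normSq_ofReal, ← Finset.mul_sum,
        ← hN]
      rw [← mul_inv, Real.mul_self_sqrt hpos.le, inv_mul_cancel₀ hpos.ne']
    · rw [← pureTensorPow_smul, smul_smul, ← Complex.ofReal_mul, mul_inv_cancel₀ hs]
      simp

/-- the maximally mixed invariant state of permutation symmetry,
`ρ_𝒮 = P_𝒮 / Tr(P_𝒮)` where `P_𝒮` is the orthogonal projector (a Hermitian idempotent
with range `𝒮`), is fully separable: it is a finite convex combination of `L`-fold
tensor powers of rank-one projections onto unit vectors of `ℂ^d`. -/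
theorem stmt6 (d L : ℕ) [NeZero L] (hd : 2 ≤ d) (hL : 1 ≤ L)
    (P : Matrix (ZMod L → Fin d) (ZMod L → Fin d) ℂ)
    (hHerm : P.IsHermitian) (hIdem : P * P = P)
    (hRange : LinearMap.range P.mulVecLin = permSym d L) :
    ∃ (n : ℕ) (p : Fin n → ℝ) (ψ : Fin n → Fin d → ℂ),
      (∀ α, 0 ≤ p α) ∧ (∑ α, p α = 1) ∧
      (∀ α, ∑ q, Complex.normSq (ψ α q) = 1) ∧
      P.trace⁻¹ • P = ∑ α, (p α : ℂ) • pureTensorPow d L (ψ α) := by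
  have hfac : (L.factorial : ℂ) ≠ 0 := by exact_mod_cast L.factorial_ne_zero
  have hS := permSum_eq_smul_projector hHerm hIdem hRange
  obtain ⟨κ, _, w, ψ, hw, hdecomp⟩ := permSum_eq_sum_pureTensorPow d L
  choose c φ hc hφ hψ using fun i => exists_unit_pureTensorPow (L := L) (by omega : 0 < d) (ψ i)
  have hP : permSum d L = ∑ i, ((w i * c i : ℝ) : ℂ) • pureTensorPow d L (φ i) := by
    rw [hdecomp]
    refine Finset.sum_congr rfl fun i _ => ?_
    rw [hψ i, smul_smul, Complex.ofReal_mul]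
  have htr : (permSum d L).trace = ((∑ i, w i * c i : ℝ) : ℂ) := by
    rw [hP, Matrix.trace_sum]
    simp [Matrix.trace_smul, trace_pureTensorPow, hφ]
  have hT0 : (∑ i, w i * c i) ≠ 0 := by
    intro h0
    have hz := (Finset.sum_eq_zero_iff_of_nonneg fun i _ => mul_nonneg (hw i) (hc i)).mp h0
    have hzero : permSum d L = 0 := by
      rw [hP]
      exact Finset.sum_eq_zero fun i hi => by rw [hz i hi]; simp
    have hone := permSum_mulVec_of_mem (d := d) (L := L) (v := fun _ => 1) fun _ _ => rfl
    rw [hzero, Matrix.zero_mulVec] at hone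
    have := congrFun hone fun _ => ⟨0, by omega⟩
    simp at this
    exact hfac (by exact_mod_cast this.symm)
  let e := Fintype.equivFin κ
  refine ⟨Fintype.card κ, fun α => (w (e.symm α) * c (e.symm α)) / ∑ i, w i * c i,
    fun α => φ (e.symm α), fun α => ?_, ?_, fun α => hφ _, ?_⟩
  · exact div_nonneg (mul_nonneg (hw _) (hc _))
      (Finset.sum_nonneg fun i _ => mul_nonneg (hw i) (hc i))
  · rw [← Finset.sum_div, e.symm.sum_comp fun i => w i * c i, div_self hT0]
  · have hscale : P.trace⁻¹ • P = (permSum d L).trace⁻¹ • permSum d L := by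
      rw [hS, Matrix.trace_smul, smul_smul, smul_eq_mul, mul_inv_rev, mul_assoc,
        inv_mul_cancel₀ hfac, mul_one]
    rw [hscale, htr, e.symm.sum_comp fun i =>
      (((w i * c i) / ∑ j, w j * c j : ℝ) : ℂ) • pureTensorPow d L (φ i)]
    conv_lhs => rw [hP, Finset.smul_sum]
    refine Finset.sum_congr rfl fun i _ => ?_
    rw [smul_smul, ← Complex.ofReal_inv, ← Complex.ofReal_mul, inv_mul_eq_div]
end
end

section
/- Let H_A, H_B, H_C be finite-dimensional complex Hilbert spaces and let ρ be a positive semidefinite operator of trace one on H_A ⊗ H_B ⊗ H_C. If the partial trace Tr_C(ρ) is a rank-one projection |Ψ_{AB}⟩⟨Ψ_{AB}| and the partial trace Tr_A(ρ) is a rank-one projection |Φ_{BC}⟩⟨Φ_{BC}|, then ρ is the rank-one projection onto a tripartite product vector: there exist unit vectors ψ_A ∈ H_A, ξ_B ∈ H_B, φ_C ∈ H_C with ρ = |ψ_A⟩⟨ψ_A| ⊗ |ξ_B⟩⟨ξ_B| ⊗ |φ_C⟩⟨φ_C|. -/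
open scoped BigOperators ComplexOrder

noncomputable section

variable {A B C : Type*} [Fintype A] [Fintype B] [Fintype C]
  [DecidableEq A] [DecidableEq B] [DecidableEq C]

/-- Partial trace over the third tensor factor `H_C`. -/
def trC (ρ : Matrix (A × B × C) (A × B × C) ℂ) : Matrix (A × B) (A × B) ℂ :=
  Matrix.of fun x y => ∑ c : C, ρ (x.1, x.2, c) (y.1, y.2, c)

/-- Partial trace over the first tensor factor `H_A`. -/
def trA (ρ : Matrix (A × B × C) (A × B × C) ℂ) : Matrix (B × C) (B × C) ℂ :=
  Matrix.of fun x y => ∑ a : A, ρ (a, x.1, x.2) (a, y.1, y.2)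

/-- If a sum of rank-one operators `|w i⟩⟨w i|` is the projection onto a unit vector `Ψ`, then
every `w i` is a multiple of `Ψ`. -/
theorem exists_eq_mul_of_sum_mul_star_eq {I X : Type*} [Fintype I] [Fintype X]
    (w : I → X → ℂ) (Ψ : X → ℂ) (hΨ : ∑ x, Complex.normSq (Ψ x) = 1)
    (h : ∀ x y, ∑ i, w i x * star (w i y) = Ψ x * star (Ψ y)) :
    ∃ t : I → ℂ, ∀ i x, w i x = Ψ x * t i := by
  have hΨ' : ∑ x, star (Ψ x) * Ψ x = 1 := by
    simpa [Complex.normSq_eq_conj_mul_self] using congrArg (fun r : ℝ => (r : ℂ)) hΨ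
  let t : I → ℂ := fun i => ∑ y, star (Ψ y) * w i y
  have hwt (x : X) : ∑ i, w i x * star (t i) = Ψ x := by
    calc ∑ i, w i x * star (t i) = ∑ y, Ψ y * ∑ i, w i x * star (w i y) := by
          simp only [t, star_sum, star_mul', star_star, Finset.mul_sum]
          rw [Finset.sum_comm]
          exact Finset.sum_congr rfl fun _ _ => Finset.sum_congr rfl fun _ _ => by ring
      _ = Ψ x * ∑ y, star (Ψ y) * Ψ y := by
          rw [Finset.mul_sum]
          exact Finset.sum_congr rfl fun _ _ => by rw [h]; ring
      _ = Ψ x := by rw [hΨ', mul_one]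
  have htw (x : X) : ∑ i, t i * star (w i x) = star (Ψ x) := by
    rw [← hwt x, star_sum]
    exact Finset.sum_congr rfl fun _ _ => by rw [star_mul', star_star, mul_comm]
  have htt : ∑ i, t i * star (t i) = 1 := by
    calc ∑ i, t i * star (t i) = ∑ y, star (Ψ y) * ∑ i, w i y * star (t i) := by
          simp only [Finset.mul_sum]
          rw [Finset.sum_comm]
          refine Finset.sum_congr rfl fun i _ => ?_
          simp only [← mul_assoc]
          rw [← Finset.sum_mul]
      _ = 1 := by simp only [hwt, hΨ']
  refine ⟨t, fun i x => ?_⟩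
  have hsum : ∑ i, (w i x - Ψ x * t i) * star (w i x - Ψ x * t i) = 0 := by
    calc ∑ i, (w i x - Ψ x * t i) * star (w i x - Ψ x * t i)
        = (∑ i, w i x * star (w i x)) - star (Ψ x) * (∑ i, w i x * star (t i))
          - Ψ x * (∑ i, t i * star (w i x)) + Ψ x * star (Ψ x) * ∑ i, t i * star (t i) := by
          simp only [Finset.mul_sum, ← Finset.sum_sub_distrib, ← Finset.sum_add_distrib]
          exact Finset.sum_congr rfl fun _ _ => by rw [star_sub, star_mul']; ring
      _ = 0 := by rw [h, hwt, htw, htt]; ring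
  have hi := (Finset.sum_eq_zero_iff_of_nonneg fun j _ => mul_star_self_nonneg _).1 hsum i
    (Finset.mem_univ i)
  exact sub_eq_zero.1 ((mul_eq_zero.1 hi).elim id star_eq_zero.1)

/-- A nonzero vector can be normalized. -/
theorem exists_normalized {X : Type*} [Fintype X] (α : X → ℂ)
    (hα : ∑ x, α x * star (α x) ≠ 0) :
    ∃ ψ : X → ℂ, ∑ x, Complex.normSq (ψ x) = 1 ∧
      ∀ x y, ψ x * (starRingEnd ℂ) (ψ y) = α x * star (α y) / ∑ z, α z * star (α z) := by
  set N : ℝ := ∑ x, Complex.normSq (α x) with hN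
  have hNc : ∑ x, α x * star (α x) = (N : ℂ) := by
    simp [hN, Complex.mul_conj]
  rw [hNc] at hα ⊢
  have hN0 : N ≠ 0 := by exact_mod_cast hα
  have hNnn : 0 ≤ N := Finset.sum_nonneg fun x _ => Complex.normSq_nonneg _
  have hsq : (Real.sqrt N : ℂ) * Real.sqrt N = N := by
    rw [← Complex.ofReal_mul, Real.mul_self_sqrt hNnn]
  refine ⟨fun x => α x / (Real.sqrt N : ℂ), ?_, fun x y => ?_⟩
  · simp only [Complex.normSq_div, Complex.normSq_ofReal, Real.mul_self_sqrt hNnn]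
    rw [← Finset.sum_div, ← hN, div_self hN0]
  · rw [map_div₀, Complex.conj_ofReal, div_mul_div_comm, hsq]
    rfl

/-- if a positive semidefinite trace-one operator `ρ` on `H_A ⊗ H_B ⊗ H_C`
has pure reduced density matrices on `AB` and on `BC` (rank-one projections
`|Ψ_{AB}⟩⟨Ψ_{AB}|` and `|Φ_{BC}⟩⟨Φ_{BC}|`), then `ρ` is the rank-one projection onto a
tripartite product vector `ψ_A ⊗ ξ_B ⊗ φ_C` of unit vectors. -/
theorem stmt8 (ρ : Matrix (A × B × C) (A × B × C) ℂ)
    (hPSD : ρ.PosSemidef) (hTr : ρ.trace = 1)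
    (Ψ : A × B → ℂ) (hΨ : ∑ x, Complex.normSq (Ψ x) = 1)
    (hAB : trC ρ = Matrix.vecMulVec Ψ (star Ψ))
    (Φ : B × C → ℂ) (hΦ : ∑ x, Complex.normSq (Φ x) = 1)
    (hBC : trA ρ = Matrix.vecMulVec Φ (star Φ)) :
    ∃ (ψA : A → ℂ) (ξB : B → ℂ) (φC : C → ℂ),
      (∑ a, Complex.normSq (ψA a) = 1) ∧
      (∑ b, Complex.normSq (ξB b) = 1) ∧
      (∑ c, Complex.normSq (φC c) = 1) ∧
      ρ = Matrix.of fun x y =>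
        (ψA x.1 * (starRingEnd ℂ) (ψA y.1)) *
        (ξB x.2.1 * (starRingEnd ℂ) (ξB y.2.1)) *
        (φC x.2.2 * (starRingEnd ℂ) (φC y.2.2)) := by
  obtain ⟨M, hM⟩ : ∃ M : Matrix (A × B × C) (A × B × C) ℂ, ρ = M.conjTranspose * M := by
    open scoped MatrixOrder in
    exact CStarAlgebra.nonneg_iff_eq_star_mul_self.1 hPSD.nonneg
  let v : A × B × C → A × B × C → ℂ := fun k x => star (M k x)
  have hv (x y) : ρ x y = ∑ k, v k x * star (v k y) := by
    simp [hM, v, Matrix.mul_apply]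
  obtain ⟨t, ht⟩ := exists_eq_mul_of_sum_mul_star_eq
    (fun (i : (A × B × C) × C) (x : A × B) => v i.1 (x.1, x.2, i.2)) Ψ hΨ fun x y => by
      have := congrFun₂ hAB x y
      simp only [trC, Matrix.of_apply, hv, Matrix.vecMulVec_apply, Pi.star_apply] at this
      rw [← this, Fintype.sum_prod_type_right]
  obtain ⟨s, hs⟩ := exists_eq_mul_of_sum_mul_star_eq
    (fun (i : (A × B × C) × A) (x : B × C) => v i.1 (i.2, x.1, x.2)) Φ hΦ fun x y => by
      have := congrFun₂ hBC x y
      simp only [trA, Matrix.of_apply, hv, Matrix.vecMulVec_apply, Pi.star_apply] at this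
      rw [← this, Fintype.sum_prod_type_right]
  replace ht (k a b c) : v k (a, b, c) = Ψ (a, b) * t (k, c) := ht (k, c) (a, b)
  replace hs (k a b c) : v k (a, b, c) = Φ (b, c) * s (k, a) := hs (k, a) (b, c)
  obtain ⟨k₀, a₀, b₀, c₀, h₀⟩ : ∃ k a b c, v k (a, b, c) ≠ 0 := by
    by_contra! hzero
    have : ρ.trace = 0 := Finset.sum_eq_zero fun ⟨a, b, c⟩ _ => by
      simp [Matrix.diag, hv, hzero]
    simp [this] at hTr
  rw [ht] at h₀
  have hΨ₀ : Ψ (a₀, b₀) ≠ 0 := left_ne_zero_of_mul h₀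
  have ht₀ : t (k₀, c₀) ≠ 0 := right_ne_zero_of_mul h₀
  let α : A → ℂ := fun a => s (k₀, a)
  let β : B → ℂ := fun b => Φ (b, c₀)
  let γ : C → ℂ := fun c => Φ (b₀, c)
  let τ : A × B × C → ℂ := fun k => s (k, a₀) / (t (k₀, c₀) * Ψ (a₀, b₀))
  have hprod (k a b c) : v k (a, b, c) = τ k * (α a * β b * γ c) := by
    have h₁ : Ψ (a, b) = Φ (b, c₀) * s (k₀, a) / t (k₀, c₀) :=
      eq_div_of_mul_eq ht₀ ((ht k₀ a b c₀).symm.trans (hs k₀ a b c₀))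
    have h₂ : t (k, c) = Φ (b₀, c) * s (k, a₀) / Ψ (a₀, b₀) :=
      eq_div_of_mul_eq hΨ₀
        ((mul_comm _ _).trans ((ht k a₀ b₀ c).symm.trans (hs k a₀ b₀ c)))
    rw [ht, h₁, h₂]
    simp only [τ, α, β, γ]
    field_simp
  set T : ℂ := ∑ k, τ k * star (τ k) with hT
  have hρ (a b c a' b' c') : ρ (a, b, c) (a', b', c') =
      T * ((α a * star (α a')) * (β b * star (β b')) * (γ c * star (γ c'))) := by
    rw [hv, hT, Finset.sum_mul]
    refine Finset.sum_congr rfl fun k _ => ?_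
    simp only [hprod, star_mul']
    ring
  have hnorm : T * ((∑ a, α a * star (α a)) * (∑ b, β b * star (β b)) *
      ∑ c, γ c * star (γ c)) = 1 := by
    rw [← hTr]
    simp only [Matrix.trace, Matrix.diag, Fintype.sum_prod_type, hρ, Finset.sum_mul_sum,
      ← Finset.mul_sum, mul_assoc]
  have hne := right_ne_zero_of_mul (hnorm.trans_ne one_ne_zero)
  have hα := left_ne_zero_of_mul (left_ne_zero_of_mul hne)
  have hβ := right_ne_zero_of_mul (left_ne_zero_of_mul hne)
  have hγ := right_ne_zero_of_mul hne
  obtain ⟨ψA, hψ, hψ'⟩ := exists_normalized α hα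
  obtain ⟨ξB, hξ, hξ'⟩ := exists_normalized β hβ
  obtain ⟨φC, hφ, hφ'⟩ := exists_normalized γ hγ
  refine ⟨ψA, ξB, φC, hψ, hξ, hφ, ?_⟩
  ext ⟨a, b, c⟩ ⟨a', b', c'⟩
  rw [Matrix.of_apply, hρ, hψ', hξ', hφ', div_mul_div_comm, div_mul_div_comm,
    eq_div_of_mul_eq hne hnorm]
  ring
end
end

section
/- Let ψ ∈ (ℂ^d)^{⊗L} be a nonzero vector satisfying Tψ = cψ for some scalar c ∈ ℂ (translation symmetry up to a phase). If ψ factorizes across a contiguous bipartition of the ring, i.e. ψ = ψ_A ⊗ ψ_B where A = {0,…,m−1} and B = {m,…,L−1} for some 1 ≤ m ≤ L−1, then ψ is a homogeneous product state: there exists φ ∈ ℂ^d with ψ = φ^{⊗L}. -/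
open scoped BigOperators

noncomputable section

/-- `ψ` satisfies all the exchange relations across `S | Sᶜ`, i.e. it has rank at most one
as a matrix indexed by the configurations on `S` and on `Sᶜ`. -/
def Exchange {ι α : Type*} [DecidableEq ι] (ψ : (ι → α) → ℂ) (S : Finset ι) : Prop :=
  ∀ σ τ, ψ σ * ψ τ = ψ (S.piecewise σ τ) * ψ (S.piecewise τ σ)

theorem Exchange.sdiff_mul {ι α : Type*} [DecidableEq ι] {ψ : (ι → α) → ℂ} {S T : Finset ι}
    (hS : Exchange ψ S) (hT : Exchange ψ T) {ω : ι → α} (hω : ψ ω ≠ 0) (σ : ι → α) :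
    ψ σ * ψ ω = ψ ((S \ T).piecewise σ ω) * ψ ((S \ T).piecewise ω σ) := by
  have h1 := hS σ ω
  have h2 := hT (S.piecewise σ ω) ω
  have h3 := hS ((S \ T).piecewise ω σ) ω
  have e1 : T.piecewise ω (S.piecewise σ ω) = (S \ T).piecewise σ ω := by
    ext i; by_cases i ∈ S <;> by_cases i ∈ T <;> simp [Finset.piecewise, *]
  have e2 : S.piecewise ((S \ T).piecewise ω σ) ω = T.piecewise (S.piecewise σ ω) ω := by
    ext i; by_cases i ∈ S <;> by_cases i ∈ T <;> simp [Finset.piecewise, *]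
  have e3 : S.piecewise ω ((S \ T).piecewise ω σ) = S.piecewise ω σ := by
    ext i; by_cases i ∈ S <;> by_cases i ∈ T <;> simp [Finset.piecewise, *]
  rw [e1] at h2
  rw [e2, e3] at h3
  apply mul_right_cancel₀ hω
  linear_combination ψ ω * h1 + ψ (S.piecewise ω σ) * h2 - ψ ((S \ T).piecewise σ ω) * h3

/-- A function which splits off every single site at a reference configuration `ω` is a product
of one-site functions. -/
theorem eq_mul_prod_of_split {ι α : Type*} [Fintype ι] [DecidableEq ι] {ψ : (ι → α) → ℂ}
    {ω : ι → α} (hω : ψ ω ≠ 0)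
    (h : ∀ i σ, ψ σ * ψ ω = ψ (Function.update ω i (σ i)) * ψ (Function.update σ i (ω i)))
    (σ : ι → α) :
    ψ σ = ψ ω * ∏ i, ψ (Function.update ω i (σ i)) / ψ ω := by
  have key : ∀ S : Finset ι,
      ψ (S.piecewise σ ω) = ψ ω * ∏ i ∈ S, ψ (Function.update ω i (σ i)) / ψ ω := by
    intro S
    induction S using Finset.induction_on with
    | empty => simp
    | insert a S ha ih =>
      have h1 := h a ((insert a S).piecewise σ ω)
      have e1 : Function.update ((insert a S).piecewise σ ω) a (ω a) = S.piecewise σ ω := by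
        ext i
        by_cases hi : i = a
        · subst hi; simp [ha]
        · simp [Finset.piecewise, hi]
      rw [e1, Finset.piecewise_insert_self, ih] at h1
      rw [Finset.prod_insert ha]
      field_simp at h1 ⊢
      linear_combination h1
  simpa using key Finset.univ

theorem Tmat_mulVec_shift (d L : ℕ) [NeZero L] (ψ : (ZMod L → Fin d) → ℂ) (σ : ZMod L → Fin d) :
    (Tmat d L).mulVec ψ (shift d L σ) = ψ σ := by
  have hinj : ∀ τ, shift d L σ = shift d L τ ↔ σ = τ := by
    refine fun τ => ⟨fun h => ?_, fun h => h ▸ rfl⟩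
    ext i
    simpa [shift] using congrArg Fin.val (congrFun h (i + 1))
  simp [Matrix.mulVec, dotProduct, Tmat, hinj]

/-- An eigenvector of a one-site translation is an eigenvector of all translations. -/
theorem exists_translate_eq {L : ℕ} [NeZero L] {α : Type*} {ψ : (ZMod L → α) → ℂ} {c : ℂ}
    (hc : ∀ σ, ψ σ = c * ψ (fun i => σ (i - 1))) (a : ZMod L) :
    ∃ k : ℂ, ∀ σ, ψ σ = k * ψ (fun i => σ (i - a)) := by
  have key : ∀ n : ℕ, ∀ σ, ψ σ = c ^ n * ψ (fun i => σ (i - n)) := by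
    intro n
    induction n with
    | zero => simp
    | succ n ih =>
      intro σ
      rw [ih, hc, pow_succ, mul_assoc]
      simp only [Nat.cast_succ, sub_sub, add_comm]
  exact ⟨c ^ a.val, by simpa using key a.val⟩

theorem Exchange.translate {L : ℕ} [NeZero L] {α : Type*} {ψ : (ZMod L → α) → ℂ} {c : ℂ}
    (hc : ∀ σ, ψ σ = c * ψ (fun i => σ (i - 1))) {S : Finset (ZMod L)} (hS : Exchange ψ S)
    (a : ZMod L) : Exchange ψ {i | i - a ∈ S} := by
  obtain ⟨k, hk⟩ := exists_translate_eq hc (-a)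
  have e : ∀ σ τ : ZMod L → α,
      (fun i => ({i | i - a ∈ S} : Finset (ZMod L)).piecewise σ τ (i - -a)) =
        S.piecewise (fun i => σ (i - -a)) (fun i => τ (i - -a)) := by
    intro σ τ
    ext i
    simp [Finset.piecewise]
  intro σ τ
  rw [hk σ, hk τ, hk (Finset.piecewise _ σ τ), hk (Finset.piecewise _ τ σ), e, e]
  linear_combination k ^ 2 * hS (fun i => σ (i - -a)) (fun i => τ (i - -a))

/-- A tensor product across `{0,…,m-1} | {m,…,L-1}` satisfies the exchange relations there. -/
theorem exchange_of_factor {L m : ℕ} [NeZero L] {α : Type*} (hm : m ≤ L)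
    {ψ : (ZMod L → α) → ℂ} {f : (Fin m → α) → ℂ} {g : (Fin (L - m) → α) → ℂ}
    (hfact : ∀ σ, ψ σ = f (fun j => σ ((j : ℕ) : ZMod L)) *
      g (fun j => σ (((m + (j : ℕ) : ℕ)) : ZMod L))) :
    Exchange ψ {i | i.val < m} := by
  have hA : ∀ j : Fin m, ((j : ℕ) : ZMod L).val < m := fun j => by
    rw [ZMod.val_natCast_of_lt (by omega)]; exact j.2
  have hB : ∀ j : Fin (L - m), ¬ ((m + (j : ℕ) : ℕ) : ZMod L).val < m := fun j => by
    rw [ZMod.val_natCast_of_lt (by omega)]; omega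
  intro σ τ
  simp only [hfact, Finset.piecewise, Finset.mem_filter, Finset.mem_univ, true_and, hA, hB,
    if_true, if_false]
  ring

theorem singleton_eq_sdiff_arc {L m : ℕ} [NeZero L] (hm1 : 1 ≤ m) (hm2 : m < L) (i : ZMod L) :
    ({j | j - i ∈ ({k | k.val < m} : Finset (ZMod L))} : Finset (ZMod L)) \
      ({j | j - (i + 1) ∈ ({k | k.val < m} : Finset (ZMod L))} : Finset (ZMod L)) = {i} := by
  ext j
  simp only [Finset.mem_sdiff, Finset.mem_filter, Finset.mem_univ, true_and, Finset.mem_singleton]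
  obtain ⟨k, rfl⟩ : ∃ k, j = i + k := ⟨j - i, by ring⟩
  rw [add_sub_cancel_left, add_sub_add_left_eq_sub, add_eq_left]
  have : Fact (1 < L) := ⟨by omega⟩
  constructor
  · rintro ⟨h1, h2⟩
    by_contra hk
    have hpos : 1 ≤ k.val := Nat.one_le_iff_ne_zero.mpr (by simpa [ZMod.val_eq_zero] using hk)
    rw [ZMod.val_sub (by rwa [ZMod.val_one])] at h2
    omega
  · rintro rfl
    have hL : (0 - 1 : ZMod L) = ((L - 1 : ℕ) : ZMod L) := by
      rw [Nat.cast_sub (by omega)]; simp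
    rw [hL, ZMod.val_natCast_of_lt (by omega), ZMod.val_zero]
    omega

/-- a nonzero vector `ψ ∈ (ℂ^d)^{⊗L}` with `Tψ = cψ` that factorizes across
the contiguous bipartition `A = {0,…,m−1}`, `B = {m,…,L−1}` (i.e. `ψ = ψ_A ⊗ ψ_B`,
expressed through coefficient functions `f` on `A`-strings and `g` on `B`-strings)
is a homogeneous product state `ψ = φ^{⊗L}`. -/
theorem stmt9 (d L : ℕ) [NeZero L] (hd : 2 ≤ d) (hL : 2 ≤ L)
    (m : ℕ) (hm1 : 1 ≤ m) (hm2 : m ≤ L - 1)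
    (ψ : (ZMod L → Fin d) → ℂ) (hψ : ψ ≠ 0)
    (c : ℂ) (hsym : (Tmat d L).mulVec ψ = c • ψ)
    (f : (Fin m → Fin d) → ℂ) (g : (Fin (L - m) → Fin d) → ℂ)
    (hfact : ∀ σ, ψ σ = f (fun j => σ ((j : ℕ) : ZMod L)) *
      g (fun j => σ (((m + (j : ℕ) : ℕ)) : ZMod L))) :
    ∃ φ : Fin d → ℂ, ∀ σ, ψ σ = ∏ i, φ (σ i) := by
  obtain ⟨ω, hω⟩ := Function.ne_iff.mp hψ
  rw [Pi.zero_apply] at hω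
  have hc : ∀ σ, ψ σ = c * ψ (fun i => σ (i - 1)) := fun σ => by
    rw [← Tmat_mulVec_shift d L ψ σ, hsym]; rfl
  have hex := exchange_of_factor (by omega) hfact
  have hprod := eq_mul_prod_of_split hω fun i σ => by
    have h := (hex.translate hc i).sdiff_mul (hex.translate hc (i + 1)) hω σ
    rwa [singleton_eq_sdiff_arc hm1 (by omega), Finset.piecewise_singleton,
      Finset.piecewise_singleton] at h
  have hprop : ∀ i, ∃ k : ℂ, ∀ s,
      ψ (Function.update ω i s) / ψ ω = k * ψ (Function.update ω 0 s) := by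
    intro i
    obtain ⟨k, hk⟩ := exists_translate_eq hc (-i)
    refine ⟨k * (∏ j ∈ Finset.univ.erase 0, ψ (Function.update ω j (ω (j + i))) / ψ ω) / ψ ω,
      fun s => ?_⟩
    have e : (fun j => Function.update ω i s (j - -i)) =
        Function.update (fun j => ω (j + i)) 0 s := by
      ext j
      simp [Function.update_apply]
    rw [hk, e, hprod, ← Finset.mul_prod_erase _ _ (Finset.mem_univ 0), Function.update_self,
      Finset.prod_congr rfl fun j hj => by rw [Function.update_of_ne (Finset.ne_of_mem_erase hj)]]
    field_simp
  choose K hK using hprop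
  obtain ⟨r, hr⟩ := IsAlgClosed.exists_pow_nat_eq (ψ ω * ∏ i, K i) (NeZero.pos L)
  refine ⟨fun s => r * ψ (Function.update ω 0 s), fun σ => ?_⟩
  rw [hprod σ]
  simp only [hK, Finset.prod_mul_distrib, Finset.prod_const, Finset.card_univ, ZMod.card, hr]
  ring
end
end

section
/- If either (d ≥ 3 and L ≥ 3) or (d = 2 and L ≥ 4), the translation-symmetry maximally mixed invariant state ρ_T is bipartite entangled across every contiguous bipartition: for every 1 ≤ m ≤ L−1, identifying H ≅ H_A ⊗ H_B with A = {0,…,m−1} and B = {m,…,L−1}, there is no finite family of probabilities p_α and unit vectors A_α ∈ H_A, B_α ∈ H_B such that ρ_T = ∑_α p_α |A_α⟩⟨A_α| ⊗ |B_α⟩⟨B_α|. -/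
open scoped BigOperators

noncomputable section

/-- The projector `P_T = (1/L)·∑_{k=0}^{L−1} T^k`. -/
def Pmat (d L : ℕ) [NeZero L] : Matrix (ZMod L → Fin d) (ZMod L → Fin d) ℂ :=
  (L : ℂ)⁻¹ • ∑ k ∈ Finset.range L, Tmat d L ^ k

/-- The maximally mixed invariant state of translation, `ρ_T = P_T / Tr(P_T)`. -/
def rhoT (d L : ℕ) [NeZero L] : Matrix (ZMod L → Fin d) (ZMod L → Fin d) ℂ :=
  ((Pmat d L).trace)⁻¹ • Pmat d L

/-- Rotation of a configuration by `c` sites. -/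
def rot {d L : ℕ} (c : ZMod L) (σ : ZMod L → Fin d) : ZMod L → Fin d := fun i => σ (i - c)

theorem rot_zero {d L : ℕ} (σ : ZMod L → Fin d) : rot 0 σ = σ := by
  funext i
  simp [rot]

theorem Tmat_pow_apply (d L : ℕ) [NeZero L] (k : ℕ) (τ σ : ZMod L → Fin d) :
    (Tmat d L ^ k) τ σ = if τ = rot (k : ZMod L) σ then 1 else 0 := by
  induction k generalizing τ σ with
  | zero => simp [Matrix.one_apply, rot_zero]
  | succ k ih =>
    rw [pow_succ, Matrix.mul_apply]
    have hT : ∀ ρ, Tmat d L ρ σ = if ρ = shift d L σ then 1 else 0 := fun _ => rfl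
    simp only [ih, hT, mul_ite, mul_one, mul_zero, Finset.sum_ite_eq', Finset.mem_univ, if_true]
    have : rot (k : ZMod L) (shift d L σ) = rot ((k + 1 : ℕ) : ZMod L) σ := by
      funext i
      simp [rot, shift, sub_sub]
    rw [this]

theorem sum_range_natCast_zmod {M : Type*} [AddCommMonoid M] (L : ℕ) [NeZero L] (f : ZMod L → M) :
    ∑ k ∈ Finset.range L, f (k : ZMod L) = ∑ c : ZMod L, f c := by
  obtain ⟨n, rfl⟩ := Nat.exists_eq_succ_of_ne_zero (NeZero.ne L)
  rw [Finset.sum_range]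
  exact Finset.sum_congr rfl fun i _ => congrArg f (Fin.cast_val_eq_self i)

/-- Number of rotations taking `σ` to `τ`. -/
def rotCount {d L : ℕ} [NeZero L] (τ σ : ZMod L → Fin d) : ℕ :=
  (Finset.univ.filter fun c : ZMod L => τ = rot c σ).card

theorem Pmat_apply (d L : ℕ) [NeZero L] (τ σ : ZMod L → Fin d) :
    Pmat d L τ σ = (L : ℂ)⁻¹ * rotCount τ σ := by
  simp only [Pmat, Matrix.smul_apply, Matrix.sum_apply, Tmat_pow_apply, smul_eq_mul]
  rw [sum_range_natCast_zmod L fun c => if τ = rot c σ then (1 : ℂ) else 0]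
  simp [rotCount]

theorem rotCount_self_pos {d L : ℕ} [NeZero L] (σ : ZMod L → Fin d) : 0 < rotCount σ σ :=
  Finset.card_pos.2 ⟨0, by simp [rot_zero]⟩

theorem rotCount_rot_left {d L : ℕ} [NeZero L] (a : ZMod L) (τ σ : ZMod L → Fin d) :
    rotCount (rot a τ) σ = rotCount τ σ := by
  refine Finset.card_nbij' (fun c => c - a) (fun c => c + a) ?_ ?_ ?_ ?_
  · intro c hc
    simp only [Finset.coe_filter, Finset.mem_univ, true_and, Set.mem_ofPred_eq] at hc ⊢
    funext i
    have := congrFun hc (i + a)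
    simp only [rot, add_sub_cancel_right] at this ⊢
    rw [this]; congr 1; ring
  · intro c hc
    simp only [Finset.coe_filter, Finset.mem_univ, true_and, Set.mem_ofPred_eq] at hc ⊢
    funext i
    rw [hc]
    simp only [rot]
    congr 1; ring
  · intro c _; simp
  · intro c _; simp

theorem rotCount_comm {d L : ℕ} [NeZero L] (τ σ : ZMod L → Fin d) :
    rotCount τ σ = rotCount σ τ := by
  refine Finset.card_nbij' (fun c => -c) (fun c => -c) ?_ ?_ ?_ ?_
  · intro c hc
    simp only [Finset.coe_filter, Finset.mem_univ, true_and, Set.mem_ofPred_eq] at hc ⊢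
    funext i
    rw [hc]; simp [rot]
  · intro c hc
    simp only [Finset.coe_filter, Finset.mem_univ, true_and, Set.mem_ofPred_eq] at hc ⊢
    funext i
    rw [hc]; simp [rot]
  · intro c _; simp
  · intro c _; simp

theorem exists_rhoT_apply (d L : ℕ) [NeZero L] (hd : 0 < d) :
    ∃ K : ℂ, K ≠ 0 ∧ ∀ τ σ : ZMod L → Fin d, rhoT d L τ σ = K * rotCount τ σ := by
  have hL : (L : ℂ) ≠ 0 := Nat.cast_ne_zero.2 (NeZero.ne L)
  refine ⟨((Pmat d L).trace)⁻¹ * (L : ℂ)⁻¹, mul_ne_zero (inv_ne_zero ?_) (inv_ne_zero hL), ?_⟩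
  · simp only [Matrix.trace, Matrix.diag_apply, Pmat_apply]
    rw [← Finset.mul_sum, ← Nat.cast_sum]
    refine mul_ne_zero (inv_ne_zero hL) (Nat.cast_ne_zero.2 (ne_of_gt ?_))
    exact Finset.sum_pos (fun σ _ => rotCount_self_pos σ) ⟨fun _ => ⟨0, hd⟩, Finset.mem_univ _⟩
  · intro τ σ
    simp [rhoT, Pmat_apply, mul_assoc]

theorem eq_of_mixture_form_eq_zero {ι X : Type*} [Fintype ι] (p : ι → ℝ) (hp : ∀ α, 0 ≤ p α)
    (ψ : ι → X → ℂ) (M : X → X → ℂ)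
    (hM : ∀ x y, M x y = ∑ α, (p α : ℂ) * (ψ α x * (starRingEnd ℂ) (ψ α y)))
    (x y : X) (h : M x x - M x y - M y x + M y y = 0) (α : ι) (hα : p α ≠ 0) :
    ψ α x = ψ α y := by
  have h1 : ((∑ β, p β * Complex.normSq (ψ β x - ψ β y) : ℝ) : ℂ) = 0 := by
    rw [← h, hM, hM, hM, hM, ← Finset.sum_sub_distrib, ← Finset.sum_sub_distrib,
      ← Finset.sum_add_distrib]
    push_cast
    refine Finset.sum_congr rfl fun β _ => ?_
    rw [← Complex.mul_conj, map_sub]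
    ring
  have h2 := (Finset.sum_eq_zero_iff_of_nonneg fun β _ =>
    mul_nonneg (hp β) (Complex.normSq_nonneg _)).1 (Complex.ofReal_eq_zero.1 h1) α
      (Finset.mem_univ _)
  exact sub_eq_zero.1 (Complex.normSq_eq_zero.1 ((mul_eq_zero.1 h2).resolve_left hα))

/-- `ψ` has rank one across the bipartition `S | Sᶜ`, stated as an exchange identity. -/
def Splits {ι X : Type*} [DecidableEq ι] (ψ : (ι → X) → ℂ) (S : Finset ι) : Prop :=
  ∀ τ r, ψ τ * ψ r = ψ (S.piecewise τ r) * ψ (S.piecewise r τ)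

theorem Splits.sdiff {ι X : Type*} [DecidableEq ι] {ψ : (ι → X) → ℂ} {S S' : Finset ι}
    (h : Splits ψ S) (h' : Splits ψ S') (τ r : ι → X) (hr : ψ r ≠ 0) :
    ψ τ * ψ r = ψ ((S \ S').piecewise τ r) * ψ ((S \ S').piecewise r τ) := by
  have e1 := h τ r
  have e2 := h' (S.piecewise τ r) r
  have e3 := h ((S \ S').piecewise r τ) r
  have a1 : S'.piecewise r (S.piecewise τ r) = (S \ S').piecewise τ r := by
    funext i; by_cases h1 : i ∈ S <;> by_cases h2 : i ∈ S' <;> simp [Finset.piecewise, h1, h2]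
  have a2 : S.piecewise ((S \ S').piecewise r τ) r = S'.piecewise (S.piecewise τ r) r := by
    funext i; by_cases h1 : i ∈ S <;> by_cases h2 : i ∈ S' <;> simp [Finset.piecewise, h1, h2]
  have a3 : S.piecewise r ((S \ S').piecewise r τ) = S.piecewise r τ := by
    funext i; by_cases h1 : i ∈ S <;> by_cases h2 : i ∈ S' <;> simp [Finset.piecewise, h1, h2]
  rw [a1] at e2
  rw [a2, a3] at e3
  refine mul_right_cancel₀ hr ?_
  linear_combination ψ r * e1 + ψ (S.piecewise r τ) * e2 - ψ ((S \ S').piecewise τ r) * e3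

/-- The `m` consecutive sites starting at `c`. -/
def arc {L : ℕ} [NeZero L] (m : ℕ) (c : ZMod L) : Finset (ZMod L) :=
  Finset.univ.filter fun j => (j - c).val < m

theorem arc_sdiff_arc {L : ℕ} [NeZero L] {m : ℕ} (hm1 : 1 ≤ m) (hm2 : m ≤ L - 1) (c : ZMod L) :
    arc m c \ arc m (c + 1) = {c} := by
  have hL : 2 ≤ L := by omega
  have : Fact (1 < L) := ⟨hL⟩
  ext j
  simp only [arc, Finset.mem_sdiff, Finset.mem_filter, Finset.mem_univ, true_and,
    Finset.mem_singleton, ← sub_sub]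
  rw [← sub_eq_zero (a := j) (b := c)]
  generalize j - c = k
  constructor
  · rintro ⟨h1, h2⟩
    by_contra hk
    have hk' : 1 ≤ k.val := Nat.one_le_iff_ne_zero.2 ((ZMod.val_ne_zero k).2 hk)
    rw [ZMod.val_sub (by rwa [ZMod.val_one])] at h2
    omega
  · rintro rfl
    refine ⟨by simp; omega, ?_⟩
    rw [zero_sub, ZMod.val_neg_of_ne_zero, ZMod.val_one]
    omega

theorem splits_arc_zero {L d m : ℕ} [NeZero L] (hm2 : m ≤ L - 1)
    (A : (Fin m → Fin d) → ℂ) (B : (Fin (L - m) → Fin d) → ℂ) :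
    Splits (fun τ : ZMod L → Fin d => A (fun j => τ ((j : ℕ) : ZMod L)) *
      B (fun j => τ (((m + (j : ℕ) : ℕ)) : ZMod L))) (arc m 0) := by
  have hA : ∀ τ r : ZMod L → Fin d, (fun j : Fin m => (arc m 0).piecewise τ r ((j : ℕ) : ZMod L)) =
      fun j : Fin m => τ ((j : ℕ) : ZMod L) := by
    intro τ r
    funext j
    refine Finset.piecewise_eq_of_mem _ _ _ ?_
    have := j.2
    simp only [arc, Finset.mem_filter, Finset.mem_univ, true_and, sub_zero]
    rw [ZMod.val_natCast_of_lt] <;> omega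
  have hB : ∀ τ r : ZMod L → Fin d,
      (fun j : Fin (L - m) => (arc m 0).piecewise τ r ((m + (j : ℕ) : ℕ) : ZMod L)) =
      fun j : Fin (L - m) => r ((m + (j : ℕ) : ℕ) : ZMod L) := by
    intro τ r
    funext j
    refine Finset.piecewise_eq_of_notMem _ _ _ ?_
    have := j.2
    simp only [arc, Finset.mem_filter, Finset.mem_univ, true_and, sub_zero]
    rw [ZMod.val_natCast_of_lt] <;> omega
  intro τ r
  simp only [hA, hB]
  ring

theorem Splits.arc_of_rot {L d m : ℕ} [NeZero L] {ψ : (ZMod L → Fin d) → ℂ}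
    (h : Splits ψ (arc m 0)) (hψ : ∀ c τ, ψ (rot c τ) = ψ τ) (c : ZMod L) :
    Splits ψ (arc m c) := by
  have key : ∀ τ r : ZMod L → Fin d,
      (arc m 0).piecewise (rot (-c) τ) (rot (-c) r) = rot (-c) ((arc m c).piecewise τ r) := by
    intro τ r
    funext i
    simp [Finset.piecewise, rot, arc]
  intro τ r
  have := h (rot (-c) τ) (rot (-c) r)
  rwa [key, key, hψ, hψ, hψ, hψ] at this

theorem const_ne_zero_of_exchange {L d : ℕ} [NeZero L] {ψ : (ZMod L → Fin d) → ℂ}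
    (hψ : ∀ c τ, ψ (rot c τ) = ψ τ)
    (hex : ∀ (i : ZMod L) (τ r : ZMod L → Fin d), ψ r ≠ 0 →
      ψ τ * ψ r = ψ (Function.update r i (τ i)) * ψ (Function.update τ i (r i)))
    (r : ZMod L → Fin d) (hr : ψ r ≠ 0) (j : ZMod L) : ψ (fun _ => r j) ≠ 0 := by
  have key : ∀ I : Finset (ZMod L), ψ (I.piecewise (fun _ => r j) r) ≠ 0 := by
    intro I
    induction I using Finset.induction_on with
    | empty => simpa using hr
    | insert i I _ ih =>
      have h := hex i (rot (i - j) r) _ ih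
      have hi : rot (i - j) r i = r j := by simp [rot]
      rw [hψ, hi] at h
      rw [Finset.piecewise_insert]
      exact left_ne_zero_of_mul (h ▸ mul_ne_zero hr ih)
  simpa using key Finset.univ

theorem two_site_eq_of_exchange {L d : ℕ} [NeZero L] {ψ : (ZMod L → Fin d) → ℂ}
    (hψ : ∀ c τ, ψ (rot c τ) = ψ τ)
    (hex : ∀ (i : ZMod L) (τ r : ZMod L → Fin d), ψ r ≠ 0 →
      ψ τ * ψ r = ψ (Function.update r i (τ i)) * ψ (Function.update τ i (r i)))
    (z x y : Fin d) {i j k i' j' k' : ZMod L} (hij : i ≠ j) (hki : k ≠ i) (hkj : k ≠ j)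
    (hij' : i' ≠ j') (hki' : k' ≠ i') (hkj' : k' ≠ j') :
    ψ (Function.update (Function.update (fun _ => z) i x) j y) =
      ψ (Function.update (Function.update (fun _ => z) i' x) j' y) := by
  by_cases h0 : ψ (fun _ => z) = 0
  · have van : ∀ (τ : ZMod L → Fin d) (l : ZMod L), τ l = z → ψ τ = 0 := by
      intro τ l hl
      by_contra hτ
      exact const_ne_zero_of_exchange hψ hex τ hτ l (by rwa [hl])
    rw [van _ k (by simp [hki, hkj]), van _ k' (by simp [hki', hkj'])]
  · have move : ∀ (a b : ZMod L) (w : Fin d), ψ (Function.update (fun _ => z) a w) =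
        ψ (Function.update (fun _ => z) b w) := by
      intro a b w
      rw [← hψ (b - a) (Function.update (fun _ => z) a w)]
      congr 1
      funext l
      simp only [rot, Function.update_apply]
      have : l - (b - a) = a ↔ l = b := by
        rw [sub_eq_iff_eq_add, add_sub_cancel]
      simp only [this]
    have fact : ∀ a b : ZMod L,
        ψ (Function.update (Function.update (fun _ => z) a x) b y) * ψ (fun _ => z) =
          ψ (Function.update (fun _ => z) 0 y) *
            ψ (Function.update (Function.update (fun _ => z) a x) b z) := by
      intro a b
      rw [hex b _ _ h0]
      simp [move b 0]
    have drop : ∀ a b : ZMod L, a ≠ b →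
        Function.update (Function.update (fun _ : ZMod L => z) a x) b z =
          Function.update (fun _ => z) a x := by
      intro a b hab
      rw [Function.update_comm hab]
      simp
    refine mul_right_cancel₀ h0 ?_
    rw [fact, fact, drop _ _ hij, drop _ _ hij', move i i']

theorem rotCount_eq_zero {d L : ℕ} [NeZero L] {τ σ : ZMod L → Fin d}
    (h : ∀ c, τ ≠ rot c σ) : rotCount τ σ = 0 := by
  simp [rotCount, h]

theorem zmod_natCast_ne {L a b : ℕ} (ha : a < L) (hb : b < L) (hab : a ≠ b) :
    (a : ZMod L) ≠ (b : ZMod L) := fun h => hab <| by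
  rwa [ZMod.natCast_eq_natCast_iff', Nat.mod_eq_of_lt ha, Nat.mod_eq_of_lt hb] at h

/-- Two configurations in distinct rotation orbits that differ by a permutation of the sites. -/
theorem exists_rot_inequivalent (d L : ℕ) [NeZero L]
    (hcond : (3 ≤ d ∧ 3 ≤ L) ∨ (d = 2 ∧ 4 ≤ L)) :
    ∃ (z x y : Fin d) (i j k i' j' k' : ZMod L), i ≠ j ∧ k ≠ i ∧ k ≠ j ∧
      i' ≠ j' ∧ k' ≠ i' ∧ k' ≠ j' ∧
      ∀ c, Function.update (Function.update (fun _ => z) i' x) j' y ≠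
        rot c (Function.update (Function.update (fun _ => z) i x) j y) := by
  have h3 : 3 ≤ L := by omega
  have h01 : (0 : ZMod L) ≠ 1 := by
    simpa using zmod_natCast_ne (L := L) (a := 0) (b := 1) (by omega) (by omega) (by omega)
  have h02 : (0 : ZMod L) ≠ 2 := by
    simpa using zmod_natCast_ne (L := L) (a := 0) (b := 2) (by omega) (by omega) (by omega)
  have h12 : (1 : ZMod L) ≠ 2 := by
    simpa using zmod_natCast_ne (L := L) (a := 1) (b := 2) (by omega) (by omega) (by omega)
  rcases hcond with ⟨hd, _⟩ | ⟨rfl, hL⟩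
  · refine ⟨⟨0, by omega⟩, ⟨1, by omega⟩, ⟨2, by omega⟩, 0, 1, 2, 1, 0, 2, h01, h02.symm,
      h12.symm, h01.symm, h12.symm, h02.symm, fun c h => ?_⟩
    have e0 := congrFun h 0
    have e1 := congrFun h 1
    simp only [rot, Function.update_apply] at e0 e1
    rw [if_pos trivial] at e0
    rw [if_neg h01.symm, if_pos trivial] at e1
    split_ifs at e0 with a1 a2 <;> simp at e0
    split_ifs at e1 with b1 b2 <;> simp at e1
    exact h02 (by linear_combination a1 - b2)
  · have h03 : (0 : ZMod L) ≠ 3 := by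
      simpa using zmod_natCast_ne (L := L) (a := 0) (b := 3) (by omega) (by omega) (by omega)
    refine ⟨0, 1, 1, 0, 1, 2, 0, 2, 1, h01, h02.symm, h12.symm, h02, h01.symm, h12,
      fun c h => ?_⟩
    have e0 := congrFun h 0
    have e2 := congrFun h 2
    simp only [rot, Function.update_apply] at e0 e2
    rw [if_neg h02, if_pos trivial] at e0
    rw [if_pos trivial] at e2
    split_ifs at e0 with a1 a2 <;> simp at e0 <;>
      split_ifs at e2 with b1 b2 <;> simp at e2
    · exact h02 (by linear_combination a1 - b1)
    · exact h03 (by linear_combination a1 - b2)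
    · exact h01 (by linear_combination a2 - b1)
    · exact h02 (by linear_combination a2 - b2)

/-- under the stated conditions on `d` and `L`, for every contiguous
bipartition `A = {0,…,m−1}`, `B = {m,…,L−1}` (`1 ≤ m ≤ L−1`), the MMIS `ρ_T` admits no
decomposition `ρ_T = ∑_α p_α |A_α⟩⟨A_α| ⊗ |B_α⟩⟨B_α|` into a finite mixture of pure
product states across the bipartition. -/
theorem stmt10 (d L : ℕ) [NeZero L] (hd : 2 ≤ d) (hL : 2 ≤ L)
    (hcond : (3 ≤ d ∧ 3 ≤ L) ∨ (d = 2 ∧ 4 ≤ L))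
    (m : ℕ) (hm1 : 1 ≤ m) (hm2 : m ≤ L - 1) :
    ¬ ∃ (n : ℕ) (p : Fin n → ℝ)
        (Av : Fin n → (Fin m → Fin d) → ℂ) (Bv : Fin n → (Fin (L - m) → Fin d) → ℂ),
      (∀ α, 0 ≤ p α) ∧ (∑ α, p α = 1) ∧
      (∀ α, ∑ x, Complex.normSq (Av α x) = 1) ∧
      (∀ α, ∑ x, Complex.normSq (Bv α x) = 1) ∧
      rhoT d L = ∑ α, (p α : ℂ) • Matrix.of (fun τ σ =>
        (Av α (fun j => τ ((j : ℕ) : ZMod L)) *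
          (starRingEnd ℂ) (Av α (fun j => σ ((j : ℕ) : ZMod L)))) *
        (Bv α (fun j => τ (((m + (j : ℕ) : ℕ)) : ZMod L)) *
          (starRingEnd ℂ) (Bv α (fun j => σ (((m + (j : ℕ) : ℕ)) : ZMod L))))) := by
  rintro ⟨n, p, Av, Bv, hp, hsum, -, -, hρ⟩
  obtain ⟨K, hK, hrho⟩ := exists_rhoT_apply d L (by omega)
  set ψ : Fin n → (ZMod L → Fin d) → ℂ := fun α τ =>
    Av α (fun j => τ ((j : ℕ) : ZMod L)) *
      Bv α (fun j => τ (((m + (j : ℕ) : ℕ)) : ZMod L)) with hψdef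
  have hM : ∀ τ σ, rhoT d L τ σ = ∑ α, (p α : ℂ) * (ψ α τ * (starRingEnd ℂ) (ψ α σ)) := by
    intro τ σ
    rw [hρ]
    simp only [Matrix.sum_apply, Matrix.smul_apply, Matrix.of_apply, smul_eq_mul, hψdef, map_mul]
    refine Finset.sum_congr rfl fun α _ => ?_
    ring
  have hinv : ∀ α, p α ≠ 0 → ∀ c τ, ψ α (rot c τ) = ψ α τ := by
    intro α hα c τ
    refine eq_of_mixture_form_eq_zero p hp ψ _ hM _ _ ?_ α hα
    simp only [hrho, rotCount_rot_left, rotCount_comm τ (rot c τ)]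
    ring
  obtain ⟨z, x, y, i, j, k, i', j', k', hij, hki, hkj, hij', hki', hkj', hne⟩ :=
    exists_rot_inequivalent d L hcond
  set σ := Function.update (Function.update (fun _ : ZMod L => z) i x) j y
  set σ' := Function.update (Function.update (fun _ : ZMod L => z) i' x) j' y
  have heq : ∀ α, p α ≠ 0 → ψ α σ = ψ α σ' := by
    intro α hα
    have hS : ∀ c, Splits (ψ α) (arc m c) :=
      (splits_arc_zero hm2 (Av α) (Bv α)).arc_of_rot (hinv α hα)
    refine two_site_eq_of_exchange (hinv α hα) (fun l τ r hr => ?_) z x y hij hki hkj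
      hij' hki' hkj'
    have h := (hS l).sdiff (hS (l + 1)) τ r hr
    rwa [arc_sdiff_arc hm1 hm2, Finset.piecewise_singleton, Finset.piecewise_singleton] at h
  have hz : rhoT d L σ σ = rhoT d L σ' σ := by
    rw [hM, hM]
    refine Finset.sum_congr rfl fun α _ => ?_
    by_cases hα : p α = 0
    · simp [hα]
    · rw [heq α hα]
  rw [hrho, hrho, rotCount_eq_zero hne] at hz
  have := (rotCount_self_pos σ).ne'
  simp [hK, this] at hz
end
end

section
/- The linear span of the set uMPS(χ,d,L) of uniform matrix product states of bond dimension χ has dimension at most the binomial coefficient C(L + dχ² − 1, dχ² − 1); in particular, for fixed χ and d it grows at most polynomially in L, of degree dχ² − 1. -/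
open scoped BigOperators

noncomputable section

/-- The set of uniform matrix product states of bond dimension `χ` on `L` qudits of
local dimension `d`: states whose coefficient on the basis string `σ` equals
`Tr(A^{σ_0} A^{σ_1} ⋯ A^{σ_{L−1}})` for some family `A` of `χ×χ` complex matrices. -/
def uMPS (χ d L : ℕ) : Set ((ZMod L → Fin d) → ℂ) :=
  {ψ | ∃ A : Fin d → Matrix (Fin χ) (Fin χ) ℂ,
    ∀ σ, ψ σ = Matrix.trace (((List.range L).map fun i => A (σ ((i : ℕ) : ZMod L))).prod)}

open MvPolynomial in
/-- The entries of a product of matrices of linear forms are forms of degree the number of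
factors. -/
theorem isHomogeneous_list_prod_apply {τ n R : Type*} [CommSemiring R] [Fintype n]
    [DecidableEq n] (l : List (Matrix n n (MvPolynomial τ R)))
    (hl : ∀ M ∈ l, ∀ i j, (M i j).IsHomogeneous 1) (i j : n) :
    (l.prod i j).IsHomogeneous l.length := by
  induction l generalizing i j with
  | nil =>
    rw [List.prod_nil, Matrix.one_apply, List.length_nil]
    split_ifs
    · exact isHomogeneous_one τ R
    · exact isHomogeneous_zero τ R 0
  | cons M l ih =>
    rw [List.prod_cons, Matrix.mul_apply, List.length_cons, add_comm]
    refine IsHomogeneous.sum _ _ _ fun k _ => ?_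
    exact (hl M (by simp) i k).mul (ih (fun N hN => hl N (by simp [hN])) k j)

open MvPolynomial in
/-- Evaluations of a family of forms of degree `L` in the variables `τ` span a space of dimension
at most the number of monomials of degree `L`. -/
theorem finrank_span_eval_le {τ ι K : Type*} [Fintype τ] [DecidableEq τ] [Field K]
    (L : ℕ) (P : ι → MvPolynomial τ K) (hP : ∀ s, (P s).IsHomogeneous L) :
    Module.finrank K (Submodule.span K (Set.range fun x : τ → K => fun s => eval x (P s)))
      ≤ (Fintype.card τ).multichoose L := by
  let S : Finset (τ →₀ ℕ) := Finset.univ.finsuppAntidiag L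
  let v : S → ι → K := fun m s => (P s).coeff m
  have hsupp : ∀ s, (P s).support ⊆ S := fun s m hm => by
    rw [Finset.mem_finsuppAntidiag, ← Finsupp.degree_eq_sum]
    exact ⟨of_not_not fun h => mem_support_iff.mp hm ((hP s).coeff_eq_zero h),
      Finset.subset_univ _⟩
  have hle : Submodule.span K (Set.range fun x : τ → K => fun s => eval x (P s))
      ≤ Submodule.span K (Set.range v) := by
    rw [Submodule.span_le]
    rintro _ ⟨x, rfl⟩
    have hx : (fun s => eval x (P s)) = ∑ m : S, (∏ t, x t ^ (m : τ →₀ ℕ) t) • v m := by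
      ext s
      rw [eval_eq', Finset.sum_apply, Finset.sum_subset (hsupp s) fun m _ hm => by
        rw [notMem_support_iff.mp hm, zero_mul], ← Finset.sum_coe_sort]
      exact Finset.sum_congr rfl fun m _ => mul_comm _ _
    simp only [SetLike.mem_coe, hx]
    exact Submodule.sum_mem _ fun m _ =>
      Submodule.smul_mem _ _ (Submodule.subset_span (Set.mem_range_self m))
  have := FiniteDimensional.span_of_finite K (Set.finite_range v)
  calc _ ≤ Module.finrank K (Submodule.span K (Set.range v)) := Submodule.finrank_mono hle
    _ ≤ Fintype.card S := finrank_range_le_card v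
    _ = _ := by
      rw [Fintype.card_coe, Finset.card_finsuppAntidiag_nat_eq_multichoose, Finset.card_univ]

/-- the dimension of the linear span of `uMPS(χ,d,L)` is at most
`C(L + dχ² − 1, dχ² − 1)`; in particular, for fixed `χ` and `d` it grows at most
polynomially in `L`, of degree `dχ² − 1`. -/
theorem stmt11 (χ d L : ℕ) [NeZero L] (hd : 2 ≤ d) (hχ : 1 ≤ χ) (hL : 1 ≤ L) :
    Module.finrank ℂ (Submodule.span ℂ (uMPS χ d L))
      ≤ (L + d * χ ^ 2 - 1).choose (d * χ ^ 2 - 1) := by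
  let τ := Fin d × Fin χ × Fin χ
  let G : Fin d → Matrix (Fin χ) (Fin χ) (MvPolynomial τ ℂ) := fun a =>
    Matrix.of fun i j => MvPolynomial.X (a, i, j)
  let P : (ZMod L → Fin d) → MvPolynomial τ ℂ := fun σ =>
    Matrix.trace (((List.range L).map fun i => G (σ ((i : ℕ) : ZMod L))).prod)
  have hP : ∀ σ, (P σ).IsHomogeneous L := fun σ => by
    refine MvPolynomial.IsHomogeneous.sum _ _ _ fun i _ => ?_
    have h := isHomogeneous_list_prod_apply
      ((List.range L).map fun i => G (σ ((i : ℕ) : ZMod L))) (by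
        simp only [List.mem_map]
        rintro _ ⟨k, -, rfl⟩ i j
        exact MvPolynomial.isHomogeneous_X ℂ _) i i
    rwa [List.length_map, List.length_range] at h
  have hsub : uMPS χ d L ⊆
      Set.range fun x : τ → ℂ => fun σ => MvPolynomial.eval x (P σ) := by
    rintro ψ ⟨A, hA⟩
    refine ⟨fun t => A t.1 t.2.1 t.2.2, funext fun σ => ?_⟩
    have hG : ∀ a, (MvPolynomial.eval fun t : τ => A t.1 t.2.1 t.2.2).mapMatrix (G a) = A a :=
      fun a => by ext i j; simp [G]
    change MvPolynomial.eval (fun t : τ => A t.1 t.2.1 t.2.2) (P σ) = ψ σ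
    rw [hA, AddMonoidHom.map_trace, ← RingHom.mapMatrix_apply, map_list_prod, List.map_map]
    simp only [Function.comp_def, hG]
  have hpos : 1 ≤ d * χ ^ 2 := Nat.mul_pos (by omega) (pow_pos hχ 2)
  have hcard : Fintype.card τ = d * χ ^ 2 := by simp [τ, sq]
  calc _ ≤ Module.finrank ℂ (Submodule.span ℂ
        (Set.range fun x : τ → ℂ => fun σ => MvPolynomial.eval x (P σ))) :=
        Submodule.finrank_mono (Submodule.span_mono hsub)
    _ ≤ (Fintype.card τ).multichoose L := finrank_span_eval_le L P hP
    _ = _ := by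
        rw [hcard, Nat.multichoose_eq, add_comm]
        exact (Nat.choose_symm_of_eq_add (by omega)).symm
end
end

section
/- Let a, b : {0,…,L−1} → ℕ and consider the operator O_{a,b} = ∏_{i=0}^{L−1} X_i^{a_i} Z_i^{b_i} built from generalized Pauli matrices. If ∑_{i=0}^{L−1} a_i ≢ 0 (mod d) or ∑_{i=0}^{L−1} b_i ≢ 0 (mod d), then Tr(ρ_T · O_{a,b}) = 0. -/
open scoped BigOperators

noncomputable section

/-- The operator `O_i`: a single-site operator `O` acting on site `i`, tensored with
the identity on all other sites. -/
def siteOp (d L : ℕ) [NeZero L] (O : Matrix (Fin d) (Fin d) ℂ) (i : ZMod L) :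
    Matrix (ZMod L → Fin d) (ZMod L → Fin d) ℂ :=
  Matrix.of fun τ σ => O (τ i) (σ i) * if (∀ j, j ≠ i → τ j = σ j) then 1 else 0

/-- The generalized Pauli clock matrix `Z`, with `Z|q⟩ = ω^q |q⟩`, `ω = exp(2πi/d)`. -/
def Zmat (d : ℕ) : Matrix (Fin d) (Fin d) ℂ :=
  Matrix.diagonal fun q => Complex.exp (2 * Real.pi * Complex.I / d) ^ (q : ℕ)

/-- The generalized Pauli shift matrix `X`, with `X|q⟩ = |q+1 mod d⟩`. -/
def Xmat (d : ℕ) : Matrix (Fin d) (Fin d) ℂ :=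
  Matrix.of fun p q => if (p : ℕ) = ((q : ℕ) + 1) % d then 1 else 0

/-- The operator `O_{a,b} = ∏_{i=0}^{L−1} X_i^{a_i} Z_i^{b_i}`. -/
def Oab (d L : ℕ) [NeZero L] (a b : ZMod L → ℕ) :
    Matrix (ZMod L → Fin d) (ZMod L → Fin d) ℂ :=
  (((List.range L).map fun i =>
    siteOp d L (Xmat d ^ a ((i : ℕ) : ZMod L) * Zmat d ^ b ((i : ℕ) : ZMod L))
      ((i : ℕ) : ZMod L))).prod

theorem eq_shift_iff {d L : ℕ} (τ ρ : ZMod L → Fin d) :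
    τ = shift d L ρ ↔ ρ = fun i => τ (i + 1) := by
  constructor
  · rintro rfl; funext i; simp [shift]
  · rintro rfl; funext i; simp [shift]

/-- The tensor product over the sites of the single-site operators `A i`. -/
def tensorOp (d L : ℕ) [NeZero L] (A : ZMod L → Matrix (Fin d) (Fin d) ℂ) :
    Matrix (ZMod L → Fin d) (ZMod L → Fin d) ℂ :=
  Matrix.of fun τ σ => ∏ i, A i (τ i) (σ i)

section

variable {d L : ℕ} [NeZero L]

theorem tensorOp_mul (A B : ZMod L → Matrix (Fin d) (Fin d) ℂ) :
    tensorOp d L A * tensorOp d L B = tensorOp d L (A * B) := by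
  ext τ σ
  simp [tensorOp, Matrix.mul_apply, Finset.prod_univ_sum, Finset.prod_mul_distrib]

theorem tensorOp_one : tensorOp d L 1 = 1 := by
  ext τ σ
  simp [tensorOp, Matrix.one_apply, Finset.prod_ite_zero, funext_iff]

theorem tensorOp_update_smul (A : ZMod L → Matrix (Fin d) (Fin d) ℂ) (i : ZMod L) (c : ℂ)
    (M : Matrix (Fin d) (Fin d) ℂ) :
    tensorOp d L (Function.update A i (c • M)) = c • tensorOp d L (Function.update A i M) := by
  ext τ σ
  simp only [tensorOp, Matrix.of_apply, Matrix.smul_apply, smul_eq_mul]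
  rw [← Finset.mul_prod_erase _ _ (Finset.mem_univ i),
    ← Finset.mul_prod_erase _ (fun j => Function.update A i M j (τ j) (σ j)) (Finset.mem_univ i),
    ← mul_assoc]
  congr 1
  · simp
  · refine Finset.prod_congr rfl fun j hj => ?_
    simp [Function.update_of_ne (Finset.ne_of_mem_erase hj)]

theorem siteOp_eq_tensorOp (O : Matrix (Fin d) (Fin d) ℂ) (i : ZMod L) :
    siteOp d L O i = tensorOp d L (Function.update 1 i O) := by
  ext τ σ
  simp only [siteOp, tensorOp, Matrix.of_apply]
  rw [← Finset.mul_prod_erase _ _ (Finset.mem_univ i), Function.update_self]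
  congr 1
  rw [Finset.prod_congr rfl (g := fun j => if τ j = σ j then (1 : ℂ) else 0) fun j hj => by
    simp [Function.update_of_ne (Finset.ne_of_mem_erase hj), Matrix.one_apply]]
  simp [Finset.prod_ite_zero]

/-- A uniform tensor power commutes with a single-site operator up to the single-site phase. -/
theorem tensorOp_const_mul_siteOp {M O : Matrix (Fin d) (Fin d) ℂ} {c : ℂ}
    (h : M * O = c • (O * M)) (i : ZMod L) :
    tensorOp d L (fun _ => M) * siteOp d L O i =
      c • (siteOp d L O i * tensorOp d L (fun _ => M)) := by
  have hl : (fun _ => M) * Function.update (1 : ZMod L → Matrix (Fin d) (Fin d) ℂ) i O =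
      Function.update (fun _ : ZMod L => M) i (c • (O * M)) := by
    funext j
    by_cases hj : j = i
    · subst hj; simp [h]
    · simp [Function.update_of_ne hj]
  have hr : Function.update (1 : ZMod L → Matrix (Fin d) (Fin d) ℂ) i O * (fun _ => M) =
      Function.update (fun _ : ZMod L => M) i (O * M) := by
    funext j
    by_cases hj : j = i
    · subst hj; simp
    · simp [Function.update_of_ne hj]
  rw [siteOp_eq_tensorOp, tensorOp_mul, tensorOp_mul, hl, hr, tensorOp_update_smul]

theorem mul_list_prod_eq_smul {ι R A : Type*} [CommSemiring R] [Semiring A] [Algebra R A]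
    (u : A) (f : ι → A) (c : ι → R) (h : ∀ i, u * f i = c i • (f i * u)) (l : List ι) :
    u * (l.map f).prod = (l.map c).prod • ((l.map f).prod * u) := by
  induction l with
  | nil => simp
  | cons i l ih =>
    simp only [List.map_cons, List.prod_cons]
    rw [← mul_assoc, h, smul_mul_assoc, mul_assoc, ih, mul_smul_comm, smul_smul, mul_assoc]

theorem sum_map_range_natCast_zmod (f : ZMod L → ℕ) :
    ((List.range L).map fun i : ℕ => f (i : ZMod L)).sum = ∑ i, f i := by
  rw [← List.sum_toFinset _ List.nodup_range, List.toFinset_range]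
  refine Finset.sum_nbij' (fun i => (i : ZMod L)) ZMod.val ?_ ?_ ?_ ?_ ?_
  · simp
  · simp [ZMod.val_lt]
  · intro i hi
    exact ZMod.val_cast_of_lt (Finset.mem_range.1 hi)
  · simp
  · simp

theorem tensorOp_const_mul_Oab {M : Matrix (Fin d) (Fin d) ℂ} {ζ : ℂ} {a b e : ZMod L → ℕ}
    (h : ∀ i, M * (Xmat d ^ a i * Zmat d ^ b i) =
      ζ ^ e i • (Xmat d ^ a i * Zmat d ^ b i * M)) :
    tensorOp d L (fun _ => M) * Oab d L a b =
      ζ ^ (∑ i, e i) • (Oab d L a b * tensorOp d L (fun _ => M)) := by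
  rw [Oab, mul_list_prod_eq_smul _ _ (fun i : ℕ => ζ ^ e (i : ZMod L))
    fun i => tensorOp_const_mul_siteOp (h i) _, ← sum_map_range_natCast_zmod e]
  congr 1
  induction List.range L with
  | nil => simp
  | cons i l ih => simp [pow_add, ih]

theorem commute_tensorOp_Tmat (M : Matrix (Fin d) (Fin d) ℂ) :
    Commute (tensorOp d L (fun _ => M)) (Tmat d L) := by
  ext τ σ
  simp only [Matrix.mul_apply, Tmat, Matrix.of_apply, mul_ite, mul_one, mul_zero, ite_mul, one_mul,
    zero_mul]
  simp only [eq_shift_iff τ, Finset.sum_ite_eq', Finset.mem_univ, if_true,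
    tensorOp, Matrix.of_apply, shift]
  exact (Fintype.prod_equiv (Equiv.addRight 1) _ _ fun i => by simp).symm

theorem commute_tensorOp_rhoT (M : Matrix (Fin d) (Fin d) ℂ) :
    Commute (tensorOp d L (fun _ => M)) (rhoT d L) :=
  ((Commute.sum_right _ _ _ fun k _ =>
    (commute_tensorOp_Tmat M).pow_right k).smul_right _).smul_right _

theorem trace_mul_eq_zero_of_twisted_commute {n : Type*} [Fintype n] [DecidableEq n]
    {U V P O : Matrix n n ℂ} {c : ℂ} (hVU : V * U = 1) (hP : Commute U P)
    (hO : U * O = c • (O * U)) (hc : c ≠ 1) : (P * O).trace = 0 := by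
  have hUV : U * V = 1 := mul_eq_one_comm.1 hVU
  have key : c * (P * O).trace = (P * O).trace := calc
    c * (P * O).trace = (P * (c • (O * U)) * V).trace := by
      rw [mul_smul_comm, smul_mul_assoc, Matrix.trace_smul, smul_eq_mul, ← mul_assoc,
        mul_assoc (P * O), hUV, mul_one]
    _ = (U * (P * O) * V).trace := by rw [← hO, ← mul_assoc, ← hP.eq, mul_assoc U]
    _ = (P * O).trace := by rw [Matrix.trace_mul_comm, ← mul_assoc, hVU, one_mul]
  by_contra hne
  exact hc (mul_right_cancel₀ hne (by rw [key, one_mul]))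

theorem trace_rhoT_mul_Oab_eq_zero {M N : Matrix (Fin d) (Fin d) ℂ} {ζ : ℂ} {a b e : ZMod L → ℕ}
    (hNM : N * M = 1)
    (h : ∀ i, M * (Xmat d ^ a i * Zmat d ^ b i) =
      ζ ^ e i • (Xmat d ^ a i * Zmat d ^ b i * M))
    (hζ : ζ ^ (∑ i, e i) ≠ 1) : (rhoT d L * Oab d L a b).trace = 0 := by
  refine trace_mul_eq_zero_of_twisted_commute (V := tensorOp d L fun _ => N) ?_
    (commute_tensorOp_rhoT M) (tensorOp_const_mul_Oab h) hζ
  rw [tensorOp_mul, ← tensorOp_one]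
  congr 1
  funext i
  exact hNM

theorem mul_pow_eq_smul {R A : Type*} [CommSemiring R] [Semiring A] [Algebra R A]
    {u x : A} {c : R} (h : u * x = c • (x * u)) (n : ℕ) :
    u * x ^ n = c ^ n • (x ^ n * u) := by
  simpa using mul_list_prod_eq_smul u (fun _ : Unit => x) (fun _ => c) (fun _ => h)
    (List.replicate n ())

theorem Zmat_mul_Xmat (hd : d ≠ 0) :
    Zmat d * Xmat d = Complex.exp (2 * Real.pi * Complex.I / d) • (Xmat d * Zmat d) := by
  ext p q
  simp only [Zmat, Xmat, Matrix.diagonal_mul, Matrix.mul_diagonal, Matrix.smul_apply,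
    Matrix.of_apply, smul_eq_mul]
  split_ifs with hpq
  · rw [hpq, ← pow_eq_pow_mod _ (Complex.isPrimitiveRoot_exp d hd).pow_eq_one, pow_succ]
    ring
  · simp

theorem Xmat_transpose_mul_Xmat (d : ℕ) : (Xmat d).transpose * Xmat d = 1 := by
  ext p q
  have : NeZero d := ⟨by rintro rfl; exact p.elim0⟩
  have hX (r s : Fin d) : Xmat d r s = if r = s + 1 then 1 else 0 := by
    simp [Xmat, Fin.ext_iff, Fin.val_add]
  simp [Matrix.mul_apply, hX, Matrix.one_apply, eq_comm]

theorem Zmat_inv_mul_Zmat (d : ℕ) :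
    (Matrix.diagonal fun q : Fin d => (Complex.exp (2 * Real.pi * Complex.I / d) ^ (q : ℕ))⁻¹) *
      Zmat d = 1 := by
  simp [Zmat, Matrix.diagonal_mul_diagonal]

end

/-- if `∑ a_i ≢ 0 (mod d)` or `∑ b_i ≢ 0 (mod d)`, then
`Tr(ρ_T · O_{a,b}) = 0`. -/
theorem stmt17 (d L : ℕ) [NeZero L] (hd : 2 ≤ d) (hL : 1 ≤ L)
    (a b : ZMod L → ℕ)
    (h : ¬ ((d : ℕ) ∣ ∑ i, a i) ∨ ¬ ((d : ℕ) ∣ ∑ i, b i)) :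
    (rhoT d L * Oab d L a b).trace = 0 := by
  have hd0 : d ≠ 0 := by lia
  have hω := Complex.isPrimitiveRoot_exp d hd0
  have hZX := Zmat_mul_Xmat hd0
  rcases h with h | h
  · refine trace_rhoT_mul_Oab_eq_zero (Zmat_inv_mul_Zmat d) (e := a) (fun i => ?_)
      (mt (hω.pow_eq_one_iff_dvd _).1 h)
    rw [← Matrix.mul_assoc, mul_pow_eq_smul hZX, smul_mul_assoc, Matrix.mul_assoc,
      Matrix.mul_assoc, ← pow_succ', pow_succ]
  · have hXZ : Xmat d * Zmat d =
        (Complex.exp (2 * Real.pi * Complex.I / d))⁻¹ • (Zmat d * Xmat d) := by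
      rw [hZX, smul_smul, inv_mul_cancel₀ (Complex.exp_ne_zero _), one_smul]
    refine trace_rhoT_mul_Oab_eq_zero (Xmat_transpose_mul_Xmat d) (e := b) (fun i => ?_)
      (mt (hω.inv.pow_eq_one_iff_dvd _).1 h)
    rw [← Matrix.mul_assoc, ← pow_succ', pow_succ, Matrix.mul_assoc, mul_pow_eq_smul hXZ,
      mul_smul_comm, Matrix.mul_assoc]
end
end
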